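/- arXiv:1906.08944 — 15 statements merged into one kernel-verified Lean document; each statement's English description precedes it below -/
import Mathlib

section
/- Let q be a prime power. Then in the polynomial ring F_q[x] one has the identity (x^{q^3} - x)·(x^q - x)^q + (x^q - x)^{q^2+1} = (x^{q^2} - x)^{q+1}. Consequently, the two expressions (x^{q^3}-x)/(x^q-x)^{q^2-q+1} + 1 and (x^{q^2}-x)^{q+1}/(x^q-x)^{q^2+1} define the same rational function, which is the quotient map for PGL_2(F_q). -/
open Polynomial

/-- In an algebra over the finite field with `q` elements, `q`-th powers respect subtraction. -/
theorem sub_pow_fintypeCard (F : Type*) {A : Type*} [Field F] [Fintype F] [CommRing A]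
    [Algebra F A] (a b : A) :
    (a - b) ^ Fintype.card F = a ^ Fintype.card F - b ^ Fintype.card F := by
  simpa only [FiniteField.frobeniusAlgHom_apply] using
    map_sub (FiniteField.frobeniusAlgHom F A) a b

/-- The polynomial identity `(x^{q^3} - x)·(x^q - x)^q + (x^q - x)^{q^2+1} = (x^{q^2} - x)^{q+1}`
in `F_q[x]`, and the consequent equality of rational functions
`(x^{q^3}-x)/(x^q-x)^{q^2-q+1} + 1 = (x^{q^2}-x)^{q+1}/(x^q-x)^{q^2+1}`. -/
theorem stmt0 (F : Type*) [Field F] [Fintype F] (q : ℕ) (hq : Fintype.card F = q) :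
    ((X : F[X]) ^ q ^ 3 - X) * (X ^ q - X) ^ q + (X ^ q - X) ^ (q ^ 2 + 1)
      = ((X : F[X]) ^ q ^ 2 - X) ^ (q + 1) ∧
    (algebraMap F[X] (RatFunc F)) ((X : F[X]) ^ q ^ 3 - X)
        / (algebraMap F[X] (RatFunc F)) (((X : F[X]) ^ q - X) ^ (q ^ 2 - q + 1)) + 1
      = (algebraMap F[X] (RatFunc F)) (((X : F[X]) ^ q ^ 2 - X) ^ (q + 1))
        / (algebraMap F[X] (RatFunc F)) (((X : F[X]) ^ q - X) ^ (q ^ 2 + 1)) := by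
  have hsub (a b : F[X]) : (a - b) ^ q = a ^ q - b ^ q := hq ▸ sub_pow_fintypeCard F a b
  have hpoly : ((X : F[X]) ^ q ^ 3 - X) * (X ^ q - X) ^ q + (X ^ q - X) ^ (q ^ 2 + 1)
      = ((X : F[X]) ^ q ^ 2 - X) ^ (q + 1) := by
    have h3 : q ^ 3 = q * q * q := by ring
    rw [pow_succ _ (q ^ 2), pow_succ _ q]
    simp only [h3, sq q, pow_mul, hsub]
    ring
  have hne : (X : F[X]) ^ q - X ≠ 0 :=
    FiniteField.X_pow_card_sub_X_ne_zero F (hq ▸ Fintype.one_lt_card)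
  refine ⟨hpoly, ?_⟩
  have hu : algebraMap F[X] (RatFunc F) (X ^ q - X) ≠ 0 :=
    RatFunc.algebraMap_ne_zero hne
  have hexp : q ^ 2 + 1 = (q ^ 2 - q + 1) + q := by
    have := Nat.le_self_pow two_ne_zero q
    omega
  rw [← hpoly, map_add, map_mul, map_pow _ _ (q ^ 2 - q + 1), map_pow _ _ (q ^ 2 + 1),
    map_pow _ _ q, add_div, div_self (pow_ne_zero _ hu), hexp, pow_add _ _ q,
    mul_div_mul_right _ _ (pow_ne_zero q hu)]
end

section
/- Let q be a prime power. For every τ ∈ F_q with τ ≠ 0, there exists an invertible 2×2 matrix M with entries in F_q such that (trace M)^2 = τ · (det M) and such that the least integer ℓ ≥ 1 with M^ℓ a scalar matrix satisfies ℓ ≥ 3. (That is, the invariant ι(M) = (trace M)^2/det M restricted to elements of order at least 3 in PGL_2(F_q) takes every nonzero value in F_q.) -/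
/-- For every `τ ∈ F_q^×` there is an invertible `2×2` matrix `M` over `F_q` with
`(trace M)^2 = τ · det M` whose order modulo scalars is at least `3`:
the invariant `ι = trace²/det` takes every nonzero value on elements of order `≥ 3`
of `PGL_2(F_q)`. -/
theorem stmt2 (F : Type*) [Field F] [Fintype F] (q : ℕ) (hq : Fintype.card F = q)
    (τ : F) (hτ : τ ≠ 0) :
    ∃ M : Matrix (Fin 2) (Fin 2) F, M.det ≠ 0 ∧
      Matrix.trace M ^ 2 = τ * M.det ∧
      ∀ ℓ : ℕ, 1 ≤ ℓ → (∃ k : F, M ^ ℓ = k • (1 : Matrix (Fin 2) (Fin 2) F)) → 3 ≤ ℓ := by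
  refine ⟨!![0, -τ; 1, τ], ?_, ?_, ?_⟩
  · simpa [Matrix.det_fin_two] using hτ
  · simp [Matrix.det_fin_two, Matrix.trace_fin_two, sq]
  · rintro ℓ hℓ ⟨k, hk⟩
    by_contra! hlt
    have h := congrFun (congrFun hk 1) 0
    interval_cases ℓ
    · simp at h
    · simp [sq, Matrix.mul_apply, Fin.sum_univ_two, hτ] at h
end

section
/- Let q be a prime power and let M, N be invertible 2×2 matrices with entries in F_q, neither of which is a scalar matrix. Suppose (trace M)^2 · (det N) = (trace N)^2 · (det M) and trace M ≠ 0 (i.e., the common invariant ι = (trace)^2/det is nonzero). Then M and N are conjugate in PGL_2(F_q): there exist an invertible 2×2 matrix P over F_q and a scalar k ∈ F_q^× such that P M P^{-1} = k·N. -/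
open Matrix in
/-- A nonscalar `2×2` matrix over a field is similar to the companion matrix of its
characteristic polynomial. -/
theorem Matrix.exists_mul_eq_mul_companion_fin_two {F : Type*} [Field F]
    (A : Matrix (Fin 2) (Fin 2) F)
    (hA : ¬ ∃ k : F, A = k • (1 : Matrix (Fin 2) (Fin 2) F)) :
    ∃ Q : Matrix (Fin 2) (Fin 2) F, Q.det ≠ 0 ∧ A * Q = Q * !![0, -A.det; 1, A.trace] := by
  obtain ⟨x, y, hxy⟩ : ∃ x y : F,
      x * (A 1 0 * x + A 1 1 * y) - (A 0 0 * x + A 0 1 * y) * y ≠ 0 := by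
    by_contra! h
    have h10 : A 1 0 = 0 := by simpa using h 1 0
    have h01 : A 0 1 = 0 := by simpa using h 0 1
    have h11 : A 1 1 = A 0 0 := by simpa [h10, h01, sub_eq_zero] using h 1 1
    exact hA ⟨A 0 0, by ext i j; fin_cases i <;> fin_cases j <;> simp [h10, h01, h11]⟩
  refine ⟨!![x, A 0 0 * x + A 0 1 * y; y, A 1 0 * x + A 1 1 * y], ?_, ?_⟩
  · rw [det_fin_two_of]
    exact hxy
  · ext i j
    fin_cases i <;> fin_cases j <;>
      simp [Matrix.mul_apply, Fin.sum_univ_two, det_fin_two, trace_fin_two] <;> ring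

/-- Nonscalar `2×2` matrices with the same trace and determinant are conjugate. -/
theorem Matrix.exists_conj_eq_of_trace_eq_of_det_eq_fin_two {F : Type*} [Field F]
    (A B : Matrix (Fin 2) (Fin 2) F)
    (hA : ¬ ∃ k : F, A = k • (1 : Matrix (Fin 2) (Fin 2) F))
    (hB : ¬ ∃ k : F, B = k • (1 : Matrix (Fin 2) (Fin 2) F))
    (htr : A.trace = B.trace) (hdet : A.det = B.det) :
    ∃ P : Matrix (Fin 2) (Fin 2) F, P.det ≠ 0 ∧ P * A * P⁻¹ = B := by
  obtain ⟨Q, hQ, hAQ⟩ := A.exists_mul_eq_mul_companion_fin_two hA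
  obtain ⟨R, hR, hBR⟩ := B.exists_mul_eq_mul_companion_fin_two hB
  rw [htr, hdet] at hAQ
  have hQu : IsUnit Q.det := hQ.isUnit
  have hRu : IsUnit R.det := hR.isUnit
  refine ⟨R * Q⁻¹, ?_, ?_⟩
  · rw [Matrix.det_mul]
    exact mul_ne_zero hR (Matrix.isUnit_nonsing_inv_det Q hQu).ne_zero
  · rw [Matrix.mul_inv_rev, Matrix.nonsing_inv_nonsing_inv Q hQu]
    calc R * Q⁻¹ * A * (Q * R⁻¹) = R * (Q⁻¹ * (A * Q)) * R⁻¹ := by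
          simp only [Matrix.mul_assoc]
      _ = B * R * R⁻¹ := by
          rw [hAQ, Matrix.nonsing_inv_mul_cancel_left _ _ hQu, hBR]
      _ = B := Matrix.mul_nonsing_inv_cancel_right _ _ hRu


/-- Two nonscalar invertible `2×2` matrices over `F_q` with the same nonzero invariant
`ι = trace²/det` are conjugate in `PGL_2(F_q)`. -/
theorem stmt3 (F : Type*) [Field F] [Fintype F] (q : ℕ) (hq : Fintype.card F = q)
    (M N : Matrix (Fin 2) (Fin 2) F) (hM : M.det ≠ 0) (hN : N.det ≠ 0)
    (hMs : ¬ ∃ k : F, M = k • (1 : Matrix (Fin 2) (Fin 2) F))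
    (hNs : ¬ ∃ k : F, N = k • (1 : Matrix (Fin 2) (Fin 2) F))
    (hι : Matrix.trace M ^ 2 * N.det = Matrix.trace N ^ 2 * M.det)
    (htr : Matrix.trace M ≠ 0) :
    ∃ P : Matrix (Fin 2) (Fin 2) F, P.det ≠ 0 ∧
      ∃ k : F, k ≠ 0 ∧ P * M * P⁻¹ = k • N := by
  have htrN : N.trace ≠ 0 := by
    intro h
    rw [h, zero_pow two_ne_zero, zero_mul] at hι
    exact mul_ne_zero (pow_ne_zero 2 htr) hN hι
  have hk : M.trace / N.trace ≠ 0 := div_ne_zero htr htrN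
  obtain ⟨P, hP, h⟩ := M.exists_conj_eq_of_trace_eq_of_det_eq_fin_two
    ((M.trace / N.trace) • N) hMs
    (fun ⟨c, hc⟩ => hNs ⟨(M.trace / N.trace)⁻¹ * c, by
      rw [mul_smul, ← hc, inv_smul_smul₀ hk]⟩)
    (by rw [Matrix.trace_smul, smul_eq_mul, div_mul_cancel₀ _ htrN])
    (by
      rw [Matrix.det_smul, Fintype.card_fin]
      field_simp
      linear_combination -hι)
  exact ⟨P, hP, _, hk, h⟩
end

section
/- Let q be a prime power and let M be an invertible 2×2 matrix with entries in F_q that is not a scalar matrix. Let ζ be an element of the field F_{q^2} with ζ ≠ 1, satisfying ζ^{q-1} = 1 or ζ^{q+1} = 1, and such that (trace M)^2/(det M) = ζ + ζ^{-1} + 2. Then the least integer ℓ ≥ 1 such that M^ℓ is a scalar matrix equals the multiplicative order of ζ. -/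
/-- Cayley–Hamilton for `2 × 2` matrices. -/
theorem Matrix.mul_self_fin_two {R : Type*} [CommRing R] (M : Matrix (Fin 2) (Fin 2) R) :
    M * M = M.trace • M - M.det • (1 : Matrix (Fin 2) (Fin 2) R) := by
  ext i j
  fin_cases i <;> fin_cases j <;>
    simp [Matrix.mul_apply, Fin.sum_univ_two, Matrix.trace_fin_two, Matrix.det_fin_two] <;> ring

/-- Powers of a `2 × 2` matrix are linear polynomials in the matrix which interpolate the
corresponding powers of its eigenvalues `α` and `β`. -/
theorem Matrix.exists_pow_eq_smul_add_smul_one {F K : Type*} [CommRing F] [CommRing K]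
    [Algebra F K] (M : Matrix (Fin 2) (Fin 2) F) {α β : K}
    (hsum : algebraMap F K M.trace = α + β) (hprod : algebraMap F K M.det = α * β) (n : ℕ) :
    ∃ u v : F, M ^ n = u • M + v • (1 : Matrix (Fin 2) (Fin 2) F) ∧
      algebraMap F K u * α + algebraMap F K v = α ^ n ∧
      algebraMap F K u * β + algebraMap F K v = β ^ n := by
  induction n with
  | zero => exact ⟨0, 1, by simp, by simp, by simp⟩
  | succ n ih =>
    obtain ⟨u, v, hM, hα, hβ⟩ := ih
    refine ⟨u * M.trace + v, -(u * M.det), ?_, ?_, ?_⟩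
    · rw [pow_succ, hM, add_mul, smul_mul_assoc, smul_mul_assoc, one_mul, M.mul_self_fin_two]
      module
    · rw [pow_succ, ← hα]
      simp only [map_add, map_mul, map_neg, hsum, hprod]
      ring
    · rw [pow_succ, ← hβ]
      simp only [map_add, map_mul, map_neg, hsum, hprod]
      ring

/-- A power of a nonscalar `2 × 2` matrix with distinct eigenvalues `α` and `β` is scalar if and
only if the corresponding powers of `α` and `β` agree. -/
theorem Matrix.exists_pow_eq_smul_one_iff {F K : Type*} [Field F] [Field K] [Algebra F K]
    (M : Matrix (Fin 2) (Fin 2) F) (hns : ¬ ∃ k : F, M = k • (1 : Matrix (Fin 2) (Fin 2) F))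
    {α β : K} (hsum : algebraMap F K M.trace = α + β) (hprod : algebraMap F K M.det = α * β)
    (hne : α ≠ β) (n : ℕ) :
    (∃ k : F, M ^ n = k • (1 : Matrix (Fin 2) (Fin 2) F)) ↔ α ^ n = β ^ n := by
  obtain ⟨u, v, hM, hα, hβ⟩ := M.exists_pow_eq_smul_add_smul_one hsum hprod n
  constructor
  · rintro ⟨k, hk⟩
    have hu : u = 0 := by
      by_contra hu
      refine hns ⟨u⁻¹ * (k - v), ?_⟩
      have h : u • M = (k - v) • (1 : Matrix (Fin 2) (Fin 2) F) := by
        rw [sub_smul, ← hk, hM, add_sub_cancel_right]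
      rw [mul_smul, ← h, inv_smul_smul₀ hu]
    rw [← hα, ← hβ, hu]
    simp
  · intro h
    have hu : algebraMap F K u * (α - β) = 0 := by linear_combination hα - hβ + h
    have hu' : u = 0 := by simpa [sub_ne_zero.mpr hne] using hu
    exact ⟨v, by simpa [hu'] using hM⟩

/-- If `M ∈ GL_2(F_q)` is nonscalar and `ζ ∈ F_{q^2}`, `ζ ≠ 1`, satisfies `ζ^{q-1} = 1` or
`ζ^{q+1} = 1` and `trace(M)²/det(M) = ζ + ζ⁻¹ + 2`, then the order of `M` modulo scalars
equals the multiplicative order of `ζ`. -/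
theorem stmt4 (F K : Type*) [Field F] [Fintype F] [Field K] [Fintype K] [Algebra F K]
    (q : ℕ) (hq : Fintype.card F = q) (hK : Fintype.card K = q ^ 2)
    (M : Matrix (Fin 2) (Fin 2) F) (hdet : M.det ≠ 0)
    (hns : ¬ ∃ k : F, M = k • (1 : Matrix (Fin 2) (Fin 2) F))
    (ζ : K) (hζ1 : ζ ≠ 1) (hζpow : ζ ^ (q - 1) = 1 ∨ ζ ^ (q + 1) = 1)
    (hι : algebraMap F K (Matrix.trace M ^ 2 / M.det) = ζ + ζ⁻¹ + 2) :
    (∃ k : F, M ^ orderOf ζ = k • (1 : Matrix (Fin 2) (Fin 2) F)) ∧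
      ∀ ℓ : ℕ, 1 ≤ ℓ → (∃ k : F, M ^ ℓ = k • (1 : Matrix (Fin 2) (Fin 2) F)) → orderOf ζ ≤ ℓ := by
  have hζ0 : ζ ≠ 0 := by
    rintro rfl
    have hq2 : 1 < q := hq ▸ Fintype.one_lt_card
    rcases hζpow with h | h
    · rw [zero_pow (by omega)] at h
      exact zero_ne_one h
    · rw [zero_pow (by omega)] at h
      exact zero_ne_one h
  have hd : algebraMap F K M.det ≠ 0 := by simpa using hdet
  have hι' : algebraMap F K M.trace ^ 2 * ζ = (1 + ζ) ^ 2 * algebraMap F K M.det := by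
    rw [map_div₀, map_pow] at hι
    field_simp at hι
    linear_combination hι
  by_cases ht : M.trace = 0
  · have hζ : ζ = -1 := by
      have h : 1 + ζ = 0 := by simpa [ht, hd] using hι'.symm
      linear_combination h
    have horder : orderOf ζ = 2 := orderOf_eq_prime (by simp [hζ]) hζ1
    rw [horder]
    refine ⟨⟨-M.det, by rw [pow_two, M.mul_self_fin_two, ht]; module⟩, fun ℓ hℓ hk => ?_⟩
    by_contra hlt
    obtain rfl : ℓ = 1 := by omega
    exact hns (by simpa using hk)
  · have ht' : algebraMap F K M.trace ≠ 0 := by simpa using ht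
    have hζ : 1 + ζ ≠ 0 := by
      intro h
      simp [h, ht, hζ0] at hι'
    set β : K := algebraMap F K M.trace / (1 + ζ) with hβ
    have hβ0 : β ≠ 0 := div_ne_zero ht' hζ
    have hsum : algebraMap F K M.trace = ζ * β + β := by
      rw [hβ]
      field_simp
      ring
    have hprod : algebraMap F K M.det = ζ * β * β := by
      rw [hβ]
      field_simp
      linear_combination -hι'
    have hne : ζ * β ≠ β := by simpa [hβ0] using hζ1
    have key (n : ℕ) :
        (∃ k : F, M ^ n = k • (1 : Matrix (Fin 2) (Fin 2) F)) ↔ ζ ^ n = 1 := by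
      rw [M.exists_pow_eq_smul_one_iff hns hsum hprod hne, mul_pow,
        mul_eq_right₀ (pow_ne_zero n hβ0)]
    exact ⟨(key _).mpr (pow_orderOf_eq_one ζ), fun ℓ hℓ hk =>
      orderOf_le_of_pow_eq_one hℓ ((key ℓ).mp hk)⟩
end

section
/- Let q = p^e with p prime, and let M be an invertible 2×2 matrix with entries in F_q that is not a scalar matrix. Let ℓ be the least integer ≥ 1 such that M^ℓ is a scalar matrix. Then ℓ = p, or ℓ divides q - 1, or ℓ divides q + 1. -/
namespace Matrix

variable {F : Type*} [Field F]

theorem sq_eq_trace_smul_sub_det_smul (M : Matrix (Fin 2) (Fin 2) F) :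
    M * M = M.trace • M - M.det • (1 : Matrix (Fin 2) (Fin 2) F) := by
  ext i j
  fin_cases i <;> fin_cases j <;>
    simp [mul_apply, Fin.sum_univ_two, trace_fin_two, det_fin_two] <;> ring

theorem exists_pow_eq_smul_add_smul (M : Matrix (Fin 2) (Fin 2) F) (n : ℕ) :
    ∃ u v : F, M ^ n = u • M + v • (1 : Matrix (Fin 2) (Fin 2) F) := by
  induction n with
  | zero => exact ⟨0, 1, by simp⟩
  | succ n ih =>
    obtain ⟨u, v, h⟩ := ih
    refine ⟨u * M.trace + v, -(u * M.det), ?_⟩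
    rw [pow_succ, h, add_mul, smul_mul_assoc, sq_eq_trace_smul_sub_det_smul, smul_mul_assoc,
      one_mul]
    module

/-- If `M ^ ℓ` is the first positive power of `M` that is scalar, then `ℓ` divides every exponent
at which the power of `M` is scalar. -/
theorem dvd_of_pow_eq_smul_one {M : Matrix (Fin 2) (Fin 2) F} (hdet : M.det ≠ 0)
    {ℓ : ℕ} (hℓ : 1 ≤ ℓ) (hℓs : ∃ k : F, M ^ ℓ = k • (1 : Matrix (Fin 2) (Fin 2) F))
    (hleast : ∀ m : ℕ, 1 ≤ m →
      (∃ k : F, M ^ m = k • (1 : Matrix (Fin 2) (Fin 2) F)) → ℓ ≤ m)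
    {m : ℕ} (hm : ∃ k : F, M ^ m = k • (1 : Matrix (Fin 2) (Fin 2) F)) : ℓ ∣ m := by
  obtain ⟨k, hk⟩ := hℓs
  obtain ⟨c, hc⟩ := hm
  have hk0 : k ≠ 0 := by
    rintro rfl
    have h := congrArg det hk
    rw [det_pow, zero_smul, det_zero] at h
    exact pow_ne_zero _ hdet h
  rw [Nat.dvd_iff_mod_eq_zero]
  by_contra hr
  refine absurd (hleast (m % ℓ) (Nat.one_le_iff_ne_zero.2 hr) ⟨(k ^ (m / ℓ))⁻¹ * c, ?_⟩)
    (Nat.mod_lt m hℓ).not_ge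
  have h : M ^ m = k ^ (m / ℓ) • M ^ (m % ℓ) := by
    conv_lhs => rw [← Nat.div_add_mod m ℓ, pow_add, pow_mul, hk, smul_pow, one_pow,
      smul_mul_assoc, one_mul]
  rw [mul_smul, ← hc, h, inv_smul_smul₀ (pow_ne_zero _ hk0)]

theorem sub_smul_mul_sub_smul_eq_zero {M : Matrix (Fin 2) (Fin 2) F} {a : F}
    (ha : (M - a • (1 : Matrix (Fin 2) (Fin 2) F)).det = 0) :
    (M - a • (1 : Matrix (Fin 2) (Fin 2) F)) * (M - (M.trace - a) • 1) = 0 := by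
  have h : a * a - M.trace * a + M.det = 0 := by
    rw [← ha]
    simp [det_fin_two, trace_fin_two]
    ring
  have h' : (a * a - M.trace * a + M.det) • (1 : Matrix (Fin 2) (Fin 2) F) = 0 := by
    rw [h, zero_smul]
  rw [sub_mul, mul_sub, sq_eq_trace_smul_sub_det_smul, mul_smul_comm, mul_one, smul_mul_assoc,
    one_mul, ← neg_eq_zero, ← h']
  module

theorem sub_smul_mul_pow {M : Matrix (Fin 2) (Fin 2) F} {a b : F}
    (h : (M - a • (1 : Matrix (Fin 2) (Fin 2) F)) * (M - b • 1) = 0) (n : ℕ) :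
    (M - a • (1 : Matrix (Fin 2) (Fin 2) F)) * M ^ n = b ^ n • (M - a • 1) := by
  have h1 : (M - a • (1 : Matrix (Fin 2) (Fin 2) F)) * M = b • (M - a • 1) := by
    rw [mul_sub, mul_smul_comm, mul_one] at h
    exact sub_eq_zero.1 h
  induction n with
  | zero => simp
  | succ n ih => rw [pow_succ, ← mul_assoc, ih, smul_mul_assoc, h1, smul_smul, ← pow_succ]

theorem pow_card_eq_self_of_mul_eq_zero [Fintype F] {M : Matrix (Fin 2) (Fin 2) F} {a b : F}
    (hab : a ≠ b) (h : (M - a • (1 : Matrix (Fin 2) (Fin 2) F)) * (M - b • 1) = 0) :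
    M ^ Fintype.card F = M := by
  have h' : (M - b • (1 : Matrix (Fin 2) (Fin 2) F)) * (M - a • 1) = 0 := by
    rw [← h]
    simp only [sub_mul, mul_sub, smul_mul_assoc, mul_smul_comm, one_mul, mul_one]
    module
  have ha := sub_smul_mul_pow h
  have hb := sub_smul_mul_pow h'
  have ha' : (M - a • (1 : Matrix (Fin 2) (Fin 2) F)) * M ^ Fintype.card F =
      (M - a • 1) * M := by
    rw [ha, FiniteField.pow_card]
    simpa using (ha 1).symm
  have hb' : (M - b • (1 : Matrix (Fin 2) (Fin 2) F)) * M ^ Fintype.card F =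
      (M - b • 1) * M := by
    rw [hb, FiniteField.pow_card]
    simpa using (hb 1).symm
  have hs : (b - a) • M ^ Fintype.card F = (b - a) • M := by
    have e := congrArg₂ (· - ·) ha' hb'
    simp only [sub_mul, smul_mul_assoc, one_mul] at e
    rw [sub_sub_sub_cancel_left, sub_sub_sub_cancel_left] at e
    rw [sub_smul, sub_smul, e]
  exact smul_right_injective _ (sub_ne_zero.2 hab.symm) hs

theorem pow_char_eq_smul_one {p : ℕ} [Fact p.Prime] [CharP F p]
    {M : Matrix (Fin 2) (Fin 2) F} {a : F}
    (h : (M - a • (1 : Matrix (Fin 2) (Fin 2) F)) * (M - a • 1) = 0) :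
    M ^ p = a ^ p • (1 : Matrix (Fin 2) (Fin 2) F) := by
  have h0 : (M - a • (1 : Matrix (Fin 2) (Fin 2) F)) ^ p = 0 :=
    pow_eq_zero_of_le (Fact.out : p.Prime).two_le (by rw [sq, h])
  have hc : Commute M (a • (1 : Matrix (Fin 2) (Fin 2) F)) :=
    (Commute.one_right M).smul_right a
  rw [sub_pow_char_of_commute _ hc, smul_pow, one_pow] at h0
  exact sub_eq_zero.1 h0

/-- Either `M` has an eigenvalue in `F`, or the Frobenius power of `M` is one of the two
conjugates of `M`. -/
theorem pow_card_eq_or_exists_det_sub_eq_zero [Fintype F] (M : Matrix (Fin 2) (Fin 2) F) :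
    M ^ Fintype.card F = M ∨ M ^ (Fintype.card F + 1) = M.det • (1 : Matrix (Fin 2) (Fin 2) F) ∨
      ∃ a : F, (M - a • (1 : Matrix (Fin 2) (Fin 2) F)).det = 0 := by
  set N := M ^ Fintype.card F with hN
  have hchar : N.charpoly = M.charpoly := FiniteField.Matrix.charpoly_pow_card M
  have htr : N.trace = M.trace := by
    rw [trace_eq_neg_charpoly_coeff, hchar, ← trace_eq_neg_charpoly_coeff]
  have hdt : N.det = M.det := by
    rw [det_eq_sign_charpoly_coeff, hchar, ← det_eq_sign_charpoly_coeff]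
  have hNM : N * M = M * N := (Commute.pow_self M _).eq
  have hprod : (N - M) * (N + M - M.trace • (1 : Matrix (Fin 2) (Fin 2) F)) = 0 := by
    have h1 := sq_eq_trace_smul_sub_det_smul N
    have h2 := sq_eq_trace_smul_sub_det_smul M
    rw [htr, hdt] at h1
    simp only [sub_mul, mul_sub, mul_add, mul_smul_comm, mul_one, h1, h2, hNM]
    module
  by_cases hd : (N - M).det = 0
  · obtain ⟨u, v, huv⟩ := exists_pow_eq_smul_add_smul M (Fintype.card F)
    by_cases hu : u - 1 = 0
    · left
      have hu1 : u = 1 := sub_eq_zero.1 hu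
      have e : N - M = v • (1 : Matrix (Fin 2) (Fin 2) F) := by
        rw [hN, huv, hu1, one_smul, add_sub_cancel_left]
      have hv : v = 0 := by
        rw [e] at hd
        simpa [det_smul] using hd
      rw [hv, zero_smul] at e
      exact sub_eq_zero.1 e
    · refine Or.inr (Or.inr ⟨-(v / (u - 1)), ?_⟩)
      have e : N - M = (u - 1) • (M - (-(v / (u - 1))) • (1 : Matrix (Fin 2) (Fin 2) F)) := by
        rw [hN, huv, smul_sub, smul_smul, mul_neg, mul_div_cancel₀ _ hu]
        module
      rw [e, det_smul] at hd
      exact (mul_eq_zero.1 hd).resolve_left (pow_ne_zero _ hu)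
  · right; left
    have hu : IsUnit (N - M) := (isUnit_iff_isUnit_det _).2 (isUnit_iff_ne_zero.2 hd)
    have e := hu.mul_right_eq_zero.1 hprod
    have e' : N = M.trace • (1 : Matrix (Fin 2) (Fin 2) F) - M := by
      rw [← sub_eq_zero, ← e]; abel
    rw [pow_succ, ← hN, e', sub_mul, smul_mul_assoc, one_mul, sq_eq_trace_smul_sub_det_smul,
      sub_sub_cancel]

end Matrix

/-- The order modulo scalars of a nonscalar invertible `2×2` matrix over `F_q`, `q = p^e`,
is `p`, a divisor of `q - 1`, or a divisor of `q + 1`. -/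
theorem stmt5 (p e : ℕ) (hp : p.Prime) (F : Type*) [Field F] [Fintype F]
    (hq : Fintype.card F = p ^ e)
    (M : Matrix (Fin 2) (Fin 2) F) (hdet : M.det ≠ 0)
    (hns : ¬ ∃ k : F, M = k • (1 : Matrix (Fin 2) (Fin 2) F))
    (ℓ : ℕ) (hℓ1 : 1 ≤ ℓ)
    (hℓs : ∃ k : F, M ^ ℓ = k • (1 : Matrix (Fin 2) (Fin 2) F))
    (hleast : ∀ m : ℕ, 1 ≤ m →
      (∃ k : F, M ^ m = k • (1 : Matrix (Fin 2) (Fin 2) F)) → ℓ ≤ m) :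
    ℓ = p ∨ ℓ ∣ p ^ e - 1 ∨ ℓ ∣ p ^ e + 1 := by
  have hdvd {m : ℕ} (hm : ∃ k : F, M ^ m = k • (1 : Matrix (Fin 2) (Fin 2) F)) : ℓ ∣ m :=
    Matrix.dvd_of_pow_eq_smul_one hdet hℓ1 hℓs hleast hm
  have hself (h : M ^ Fintype.card F = M) : ℓ ∣ p ^ e - 1 := by
    rw [← hq]
    refine hdvd ⟨1, ?_⟩
    have hu : IsUnit M := (Matrix.isUnit_iff_isUnit_det _).2 (isUnit_iff_ne_zero.2 hdet)
    refine hu.mul_left_cancel ?_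
    rw [one_smul, mul_one, mul_pow_sub_one Fintype.card_ne_zero, h]
  rcases Matrix.pow_card_eq_or_exists_det_sub_eq_zero M with h | h | ⟨a, ha⟩
  · exact Or.inr (Or.inl (hself h))
  · rw [hq] at h
    exact Or.inr (Or.inr (hdvd ⟨_, h⟩))
  · have hmul := Matrix.sub_smul_mul_sub_smul_eq_zero ha
    by_cases hab : a = M.trace - a
    · rw [← hab] at hmul
      have : Fact p.Prime := ⟨hp⟩
      have : CharP F p := charP_of_card_eq_prime_pow hq
      refine Or.inl (((Nat.dvd_prime hp).1 (hdvd ⟨_, Matrix.pow_char_eq_smul_one hmul⟩)).resolve_left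
        ?_)
      rintro rfl
      exact hns (by simpa using hℓs)
    · exact Or.inr (Or.inl (hself (Matrix.pow_card_eq_self_of_mul_eq_zero hab hmul)))
end

section
/- Let q be a prime power and let M = [[a,b],[c,d]] be an invertible 2×2 matrix over F_q that is not scalar. Suppose ζ ∈ F_{q^2} satisfies ζ^2 ≠ 1 and ζ^{q+κ} = 1 for some κ ∈ {1,-1}, and that (a+d)^2/(ad-bc) - 2 = ζ + ζ^{-1}. Let t be the multiplicative order of ζ. Then the polynomial f(x) = x^q·(cx+d) - (ax+b) in F_q[x] factors as a product of exactly (q+κ)/t distinct monic irreducible polynomials of degree t together with factors of degree 1 (i.e., in the factorization of f into monic irreducibles over F_q, exactly (q+κ)/t of them have degree t and all the others are linear). -/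
open Polynomial UniqueFactorizationMonoid

/-- If `x ^ q` is the image of `x` under the Möbius transformation of `!![a, b; c, d]`, then
`x ^ q ^ j` is its image under the `j`-th power `s • !![a, b; c, d] + r • 1`. -/
lemma exists_coeffs_frobenius_iterate {F K A : Type*} [Field F] [Fintype F] [Field K] [Algebra F K]
    [Field A] [Algebra F A] {a b c d : F} {u v : K}
    (hadd : u + v = algebraMap F K (a + d)) (hmul : u * v = algebraMap F K (a * d - b * c))
    {x : A}
    (hx : x ^ Fintype.card F * (algebraMap F A c * x + algebraMap F A d) =
      algebraMap F A a * x + algebraMap F A b) (j : ℕ) :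
    ∃ s r : F, algebraMap F K s * (u - v) = u ^ j - v ^ j ∧
      algebraMap F K r * (u - v) = u * v ^ j - v * u ^ j ∧
      x ^ Fintype.card F ^ j *
          (algebraMap F A s * (algebraMap F A c * x + algebraMap F A d) + algebraMap F A r) =
        algebraMap F A s * (algebraMap F A a * x + algebraMap F A b) + algebraMap F A r * x := by
  induction j with
  | zero => exact ⟨0, 1, by simp, by simp, by simp⟩
  | succ j ih =>
    obtain ⟨s, r, hs, hr, h⟩ := ih
    refine ⟨s * (a + d) + r, -(a * d - b * c) * s, ?_, ?_, ?_⟩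
    · rw [map_add, map_mul, ← hadd]
      linear_combination (u + v) * hs + hr
    · rw [map_mul, map_neg, ← hmul]
      linear_combination (-(u * v)) * hs
    · have hF := congrArg (FiniteField.frobeniusAlgHom F A) h
      simp only [map_add, map_mul, map_pow, AlgHom.commutes] at hF
      simp only [FiniteField.frobeniusAlgHom_apply, ← pow_mul, ← pow_succ'] at hF
      simp only [map_add, map_mul, map_neg, map_sub]
      linear_combination (algebraMap F A c * x + algebraMap F A d) * hF -
        (x ^ Fintype.card F ^ (j + 1) * algebraMap F A s * algebraMap F A c -
          algebraMap F A s * algebraMap F A a - algebraMap F A r) * hx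

lemma pow_card_pow_eq_self_iff {F K A : Type*} [Field F] [Fintype F] [Field K] [Algebra F K]
    [Field A] [Algebra F A] {a b c d : F} (hdet : a * d - b * c ≠ 0) {ζ v : K}
    (hadd : ζ * v + v = algebraMap F K (a + d))
    (hmul : ζ * v * v = algebraMap F K (a * d - b * c)) (hζ : ζ ≠ 1)
    {x : A}
    (hx : x ^ Fintype.card F * (algebraMap F A c * x + algebraMap F A d) =
      algebraMap F A a * x + algebraMap F A b) (hfix : x ^ Fintype.card F ≠ x) (j : ℕ) :
    x ^ Fintype.card F ^ j = x ↔ ζ ^ j = 1 := by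
  obtain ⟨s, r, hs, hr, h⟩ := exists_coeffs_frobenius_iterate hadd hmul hx j
  have hv : v ≠ 0 := by
    rintro rfl
    rw [mul_zero, eq_comm, map_eq_zero] at hmul
    exact hdet hmul
  have huv : ζ * v - v ≠ 0 := by
    rw [show ζ * v - v = (ζ - 1) * v by ring]
    exact mul_ne_zero (sub_ne_zero.2 hζ) hv
  have hden : algebraMap F A c * x + algebraMap F A d ≠ 0 := by
    intro h0
    rw [h0, mul_zero] at hx
    refine hdet ((algebraMap F A).injective ?_)
    simp only [map_sub, map_mul, map_zero]
    by_cases hc : algebraMap F A c = 0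
    · have hd : algebraMap F A d = 0 := by simpa [hc] using h0
      simp [hc, hd]
    · linear_combination algebraMap F A a * h0 + algebraMap F A c * hx
  have hs0 : s = 0 ↔ ζ ^ j = 1 := by
    rw [← (algebraMap F K).injective.eq_iff, map_zero, ← mul_left_inj' huv, hs, zero_mul,
      mul_pow, sub_eq_zero, mul_eq_right₀ (pow_ne_zero j hv)]
  rw [← hs0]
  constructor
  · intro hj
    rw [hj] at h
    have h' : algebraMap F A s *
        ((algebraMap F A c * x + algebraMap F A d) * (x - x ^ Fintype.card F)) = 0 := by
      linear_combination h - algebraMap F A s * hx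
    simpa [hden, sub_eq_zero, hfix.symm] using h'
  · intro h0
    have hr0 : algebraMap F A r ≠ 0 := by
      rw [Ne, map_eq_zero]
      rintro rfl
      rw [map_zero, zero_mul, mul_pow, hs0.1 h0] at hr
      refine mul_ne_zero (pow_ne_zero j hv) huv ?_
      linear_combination -hr
    subst h0
    simp only [map_zero, zero_mul, zero_add] at h
    exact mul_right_cancel₀ hr0 (h.trans (mul_comm _ _))

lemma mem_range_algebraMap_of_pow_card_eq_self {F K : Type*} [Field F] [Fintype F] [Field K]
    [Algebra F K] [Algebra.IsIntegral F K] {z : K} (hz : z ^ Fintype.card F = z) :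
    z ∈ (algebraMap F K).range := by
  have hint : IsIntegral F z := Algebra.IsIntegral.isIntegral z
  rw [← minpoly.natDegree_eq_one_iff, ← Nat.dvd_one]
  refine (minpoly.irreducible hint).natDegree_dvd_of_dvd_X_pow_card_pow_sub_X (minpoly.dvd F z ?_)
  simp [Nat.card_eq_fintype_card, hz]

lemma filter_natDegree_eq_one_normalizedFactors {F : Type*} [Field F] [DecidableEq F] {f : F[X]}
    (hf : f.Separable) :
    (normalizedFactors f).filter (fun g => g.natDegree = 1) = f.roots.map fun x => X - C x := by
  have hf0 : f ≠ 0 := hf.ne_zero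
  refine (Multiset.Nodup.ext
    (((squarefree_iff_nodup_normalizedFactors hf0).1 hf.squarefree).filter _)
    ((nodup_roots hf).map fun x y h => by simpa using h)).2 fun g => ?_
  simp only [Multiset.mem_filter, Multiset.mem_map, Polynomial.mem_normalizedFactors_iff hf0,
    mem_roots hf0, ← dvd_iff_isRoot]
  constructor
  · rintro ⟨⟨-, hm, hdvd⟩, h1⟩
    have hg : X - C (-g.coeff 0) = g := by
      rw [C_neg, sub_neg_eq_add, ← hm.eq_X_add_C h1]
    exact ⟨-g.coeff 0, hg.symm ▸ hdvd, hg⟩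
  · rintro ⟨x, hx, rfl⟩
    exact ⟨⟨irreducible_X_sub_C x, monic_X_sub_C x, hx⟩, natDegree_X_sub_C x⟩

lemma sum_natDegree_normalizedFactors {F : Type*} [Field F] [DecidableEq F] {f : F[X]}
    (hf : f ≠ 0) : ((normalizedFactors f).map natDegree).sum = f.natDegree := by
  rw [← natDegree_multiset_prod _ (zero_notMem_normalizedFactors f)]
  exact natDegree_eq_of_degree_eq (degree_eq_degree_of_associated (prod_normalizedFactors hf))

lemma sum_map_natDegree_of_eq_or_eq_one {R : Type*} [Semiring R] {s : Multiset R[X]} {t : ℕ}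
    (ht : t ≠ 1) (h : ∀ g ∈ s, g.natDegree = t ∨ g.natDegree = 1) :
    (s.map natDegree).sum = (s.filter fun g => g.natDegree = t).card * t +
      (s.filter fun g => g.natDegree = 1).card := by
  induction s using Multiset.induction_on with
  | empty => simp
  | cons g s ih =>
    rw [Multiset.map_cons, Multiset.sum_cons,
      ih fun g hg => h g (Multiset.mem_cons_of_mem hg)]
    rcases h g (Multiset.mem_cons_self g s) with hg | hg
    · simp [hg, ht, add_mul]
      ring
    · simp [hg, ht.symm]
      ring

section FrobeniusMobius

variable {F : Type*} [Field F] [Fintype F] {a b c d : F}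

lemma separable_X_pow_card_mul_sub (hdet : a * d - b * c ≠ 0) :
    (X ^ Fintype.card F * (C c * X + C d) - (C a * X + C b) : F[X]).Separable := by
  have hC : (C (a * d - b * c)⁻¹ * (C a * C d - C b * C c) : F[X]) = 1 := by
    rw [← C_mul, ← C_mul, ← C_sub, ← C_mul, inv_mul_cancel₀ hdet, C_1]
  refine ⟨C (a * d - b * c)⁻¹ * C c, -(C (a * d - b * c)⁻¹ * (C c * X + C d)), ?_⟩
  simp only [derivative_sub, derivative_mul, derivative_X_pow, derivative_add, derivative_C,
    derivative_X, FiniteField.cast_card_eq_zero, map_zero]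
  linear_combination hC

lemma natDegree_X_pow_card_mul_sub_of_ne_zero (hc : c ≠ 0) :
    (X ^ Fintype.card F * (C c * X + C d) - (C a * X + C b) : F[X]).natDegree =
      Fintype.card F + 1 := by
  have hq : 1 < Fintype.card F := Fintype.one_lt_card
  rw [natDegree_sub_eq_left_of_natDegree_lt, natDegree_X_pow_mul, natDegree_linear hc]
  · exact Nat.add_comm _ _
  · exact fun h => hc (by simpa using congrArg (coeff · 1) h)
  · rw [natDegree_X_pow_mul _ fun h => hc (by simpa using congrArg (coeff · 1) h),
      natDegree_linear hc]
    exact natDegree_linear_le.trans_lt (by omega)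

lemma natDegree_X_pow_card_mul_sub_of_eq_zero (hd : d ≠ 0) :
    (X ^ Fintype.card F * (C 0 * X + C d) - (C a * X + C b) : F[X]).natDegree =
      Fintype.card F := by
  have hq : 1 < Fintype.card F := Fintype.one_lt_card
  have hl : (X ^ Fintype.card F * (C 0 * X + C d) : F[X]).natDegree = Fintype.card F := by
    rw [C_0, zero_mul, zero_add, natDegree_mul_C hd, natDegree_X_pow]
  rw [natDegree_sub_eq_left_of_natDegree_lt, hl]
  rw [hl]
  exact natDegree_linear_le.trans_lt hq

lemma mem_roots_X_pow_card_mul_sub (hdet : a * d - b * c ≠ 0) {x : F} :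
    x ∈ (X ^ Fintype.card F * (C c * X + C d) - (C a * X + C b) : F[X]).roots ↔
      x * (c * x + d) = a * x + b := by
  rw [mem_roots (separable_X_pow_card_mul_sub hdet).ne_zero]
  simp [FiniteField.pow_card, sub_eq_zero]

lemma natDegree_eq_of_dvd_X_pow_card_mul_sub {K : Type*} [Field K] [Algebra F K]
    (hdet : a * d - b * c ≠ 0) {ζ v : K}
    (hadd : ζ * v + v = algebraMap F K (a + d))
    (hmul : ζ * v * v = algebraMap F K (a * d - b * c)) (hζ : ζ ≠ 1)
    {g : F[X]} (hg : Irreducible g)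
    (hdvd : g ∣ X ^ Fintype.card F * (C c * X + C d) - (C a * X + C b)) :
    g.natDegree = orderOf ζ ∨ g.natDegree = 1 := by
  have : Fact (Irreducible g) := ⟨hg⟩
  have hroot : AdjoinRoot.root g ^ Fintype.card F *
      (algebraMap F _ c * AdjoinRoot.root g + algebraMap F _ d) =
        algebraMap F _ a * AdjoinRoot.root g + algebraMap F _ b := by
    have h := AdjoinRoot.mk_eq_zero.2 hdvd
    simpa [sub_eq_zero] using h
  have hdeg (n : ℕ) : g.natDegree ∣ n ↔
      AdjoinRoot.root g ^ Fintype.card F ^ n = AdjoinRoot.root g := by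
    rw [hg.natDegree_dvd_iff_dvd_X_pow_card_pow_sub_X, ← AdjoinRoot.mk_eq_zero,
      Nat.card_eq_fintype_card]
    simp [sub_eq_zero]
  by_cases hfix : AdjoinRoot.root g ^ Fintype.card F = AdjoinRoot.root g
  · right
    rwa [← Nat.dvd_one, hdeg, pow_one]
  · left
    refine Nat.dvd_right_iff_eq.1 fun n => ?_
    rw [hdeg, pow_card_pow_eq_self_iff hdet hadd hmul hζ hroot hfix, orderOf_dvd_iff_pow_eq_one]

/-- The matrix `!![a, b; c, d]` has no eigenvalue in `F` unless the ratio `ζ` of its eigenvalues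
lies in `F`. -/
lemma pow_card_eq_self_of_eigenvalue {K : Type*} [Field K] [Algebra F K]
    {T D : F} (hD : D ≠ 0) {ζ v : K}
    (hadd : ζ * v + v = algebraMap F K T) (hmul : ζ * v * v = algebraMap F K D)
    {μ : F} (hμ : μ ^ 2 - T * μ + D = 0) : ζ ^ Fintype.card F = ζ := by
  have hv : v ≠ 0 := by
    rintro rfl
    rw [mul_zero, eq_comm, map_eq_zero] at hmul
    exact hD hmul
  have hprod : (algebraMap F K μ - ζ * v) * (algebraMap F K μ - v) = 0 := by
    have h := congrArg (algebraMap F K) hμ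
    simp only [map_add, map_sub, map_mul, map_pow, map_zero, ← hadd, ← hmul] at h
    linear_combination h
  obtain ⟨w, rfl⟩ : ∃ w, algebraMap F K w = v := by
    rcases mul_eq_zero.1 hprod with h | h
    · exact ⟨T - μ, by rw [map_sub, ← hadd]; linear_combination -h⟩
    · exact ⟨μ, sub_eq_zero.1 h⟩
  obtain ⟨z, rfl⟩ : ∃ z, algebraMap F K z = ζ :=
    ⟨(T - w) / w, by rw [map_div₀, map_sub, ← hadd, add_sub_cancel_right, mul_div_cancel_right₀ _ hv]⟩
  rw [← map_pow, FiniteField.pow_card]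

lemma card_roots_X_pow_card_mul_sub_of_split (hdet : a * d - b * c ≠ 0) {z w : F}
    (hadd : z * w + w = a + d) (hmul : z * w * w = a * d - b * c) (hz : z ≠ 1) :
    (X ^ Fintype.card F * (C c * X + C d) - (C a * X + C b) : F[X]).natDegree + 1 =
      (X ^ Fintype.card F * (C c * X + C d) - (C a * X + C b) : F[X]).roots.card +
        Fintype.card F := by
  classical
  have hw : w ≠ 0 := by
    rintro rfl
    exact hdet (by rw [← hmul, mul_zero])
  have hzw : z * w ≠ w := fun h => hz (mul_right_cancel₀ hw (by rw [h, one_mul]))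
  have hnd := nodup_roots (separable_X_pow_card_mul_sub hdet)
  rw [← Multiset.toFinset_card_of_nodup hnd]
  by_cases hc : c = 0
  · subst hc
    have hd : d ≠ 0 := by
      rintro rfl
      simp at hdet
    have had : d - a ≠ 0 := by
      intro h
      have h2 : (d - z * w) * (d - w) = 0 := by
        linear_combination (-d) * hadd + hmul
      rcases mul_eq_zero.1 h2 with h3 | h3
      · exact hzw (by linear_combination -2 * h3 + h - hadd)
      · exact hzw (by linear_combination 2 * h3 - h + hadd)
    rw [natDegree_X_pow_card_mul_sub_of_eq_zero hd, Finset.card_eq_one.2 ⟨b / (d - a), ?_⟩,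
      add_comm]
    ext x
    rw [Multiset.mem_toFinset, mem_roots_X_pow_card_mul_sub hdet, Finset.mem_singleton,
      eq_div_iff had]
    constructor <;> intro h <;> linear_combination h
  · rw [natDegree_X_pow_card_mul_sub_of_ne_zero hc,
      Finset.card_eq_two.2 ⟨(z * w - d) / c, (w - d) / c, ?_, ?_⟩]
    · ring
    · intro h
      exact hzw (sub_left_injective ((div_left_inj' hc).1 h))
    · ext x
      rw [Multiset.mem_toFinset, mem_roots_X_pow_card_mul_sub hdet, Finset.mem_insert,
        Finset.mem_singleton, eq_div_iff hc, eq_div_iff hc, ← sub_eq_zero (b := z * w - d),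
        ← sub_eq_zero (b := w - d), ← mul_eq_zero, ← sub_eq_zero, ← mul_right_inj' hc, mul_zero]
      have key : c * (x * (c * x + d) - (a * x + b)) =
          (x * c - (z * w - d)) * (x * c - (w - d)) := by
        linear_combination (x * c + d) * hadd - hmul
      rw [key]

lemma natDegree_and_roots_of_pow_card_ne_self {K : Type*} [Field K] [Algebra F K]
    (hdet : a * d - b * c ≠ 0) {ζ v : K}
    (hadd : ζ * v + v = algebraMap F K (a + d))
    (hmul : ζ * v * v = algebraMap F K (a * d - b * c)) (hζ : ζ ^ Fintype.card F ≠ ζ) :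
    (X ^ Fintype.card F * (C c * X + C d) - (C a * X + C b) : F[X]).natDegree =
        Fintype.card F + 1 ∧
      (X ^ Fintype.card F * (C c * X + C d) - (C a * X + C b) : F[X]).roots = 0 := by
  constructor
  · refine natDegree_X_pow_card_mul_sub_of_ne_zero ?_
    rintro rfl
    exact hζ (pow_card_eq_self_of_eigenvalue hdet hadd hmul (μ := d) (by ring))
  · refine Multiset.eq_zero_of_forall_notMem fun x hx => ?_
    rw [mem_roots_X_pow_card_mul_sub hdet] at hx
    exact hζ (pow_card_eq_self_of_eigenvalue hdet hadd hmul (μ := c * x + d)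
      (by linear_combination c * hx))

end FrobeniusMobius

/-- Factorization of `x^q(cx+d) - (ax+b)` over `F_q`: if `ι(M) - 2 = ζ + 1/ζ` with
`ζ ∈ F_{q^2}`, `ζ² ≠ 1`, `ζ^{q+κ} = 1` for `κ ∈ {1,-1}`, and `t = ord(ζ)`, then the
polynomial has exactly `(q+κ)/t` distinct monic irreducible factors of degree `t` and
all remaining factors are linear. -/
theorem stmt6 (F K : Type*) [Field F] [Fintype F] [DecidableEq F] [Field K] [Fintype K] [Algebra F K]
    (q : ℕ) (hq : Fintype.card F = q) (hK : Fintype.card K = q ^ 2)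
    (a b c d : F) (hdet : a * d - b * c ≠ 0)
    (hns : ¬ ∃ k : F, !![a, b; c, d] = k • (1 : Matrix (Fin 2) (Fin 2) F))
    (ζ : K) (hζ2 : ζ ^ 2 ≠ 1) (κ : ℤ) (hκ : κ = 1 ∨ κ = -1)
    (hζpow : ζ ^ ((q : ℤ) + κ) = 1)
    (hι : algebraMap F K ((a + d) ^ 2 / (a * d - b * c)) - 2 = ζ + ζ⁻¹)
    (t : ℕ) (ht : t = orderOf ζ)
    (f : F[X]) (hf : f = X ^ q * (C c * X + C d) - (C a * X + C b)) :
    ((((normalizedFactors f).filter fun g => g.natDegree = t).card : ℤ) * t = (q : ℤ) + κ) ∧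
    ((normalizedFactors f).filter fun g => g.natDegree = t).Nodup ∧
    ∀ g ∈ normalizedFactors f, g.natDegree = t ∨ g.natDegree = 1 := by
  subst hq ht hf
  have hζ1 : ζ ≠ 1 := by
    rintro rfl
    exact hζ2 (one_pow 2)
  have hζ0 : ζ ≠ 0 := by
    rintro rfl
    have hq : 1 < Fintype.card F := Fintype.one_lt_card
    rw [zero_zpow _ (by omega)] at hζpow
    exact zero_ne_one hζpow
  have hζm : ζ + 1 ≠ 0 := fun h => hζ2 (by linear_combination (ζ - 1) * h)
  obtain ⟨v, hadd, hmul⟩ : ∃ v : K, ζ * v + v = algebraMap F K (a + d) ∧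
      ζ * v * v = algebraMap F K (a * d - b * c) := by
    have hv : ζ * (algebraMap F K (a + d) / (ζ + 1)) + algebraMap F K (a + d) / (ζ + 1) =
        algebraMap F K (a + d) := by
      field_simp
    refine ⟨_, hv, mul_right_cancel₀ (pow_ne_zero 2 hζm) ?_⟩
    have hD : algebraMap F K (a * d - b * c) ≠ 0 := (_root_.map_ne_zero _).2 hdet
    rw [map_div₀, map_pow] at hι
    field_simp at hι ⊢
    linear_combination hι
  have hsep := separable_X_pow_card_mul_sub hdet
  have hdeg : ∀ g ∈ normalizedFactors
      (X ^ Fintype.card F * (C c * X + C d) - (C a * X + C b)),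
      g.natDegree = orderOf ζ ∨ g.natDegree = 1 := fun g hg =>
    natDegree_eq_of_dvd_X_pow_card_mul_sub hdet hadd hmul hζ1 (irreducible_of_normalized_factor g hg)
      (dvd_of_mem_normalizedFactors hg)
  refine ⟨?_, ((squarefree_iff_nodup_normalizedFactors hsep.ne_zero).1 hsep.squarefree).filter _,
    hdeg⟩
  have hsum := sum_natDegree_normalizedFactors hsep.ne_zero
  have hlin := congrArg Multiset.card (filter_natDegree_eq_one_normalizedFactors hsep)
  rw [Multiset.card_map] at hlin
  rw [sum_map_natDegree_of_eq_or_eq_one (by rwa [Ne, orderOf_eq_one_iff]) hdeg, hlin] at hsum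
  rcases hκ with rfl | rfl
  · have hpow : ζ ^ Fintype.card F ≠ ζ := fun h => by
      have h' : ζ ^ (Fintype.card F + 1) = 1 := mod_cast hζpow
      rw [pow_succ, h, ← sq] at h'
      exact hζ2 h'
    obtain ⟨hd, hr⟩ := natDegree_and_roots_of_pow_card_ne_self hdet hadd hmul hpow
    rw [hd, hr, Multiset.card_zero, add_zero] at hsum
    exact_mod_cast hsum
  · have hpow : ζ ^ Fintype.card F = ζ := by
      rwa [zpow_add₀ hζ0, zpow_natCast, zpow_neg_one, mul_inv_eq_one₀ hζ0] at hζpow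
    obtain ⟨z, rfl⟩ := mem_range_algebraMap_of_pow_card_eq_self hpow
    obtain ⟨w, rfl⟩ : ∃ w, algebraMap F K w = v :=
      ⟨(a + d) / (z + 1), by rw [map_div₀, ← hadd, map_add, map_one]; field_simp⟩
    have hcard := card_roots_X_pow_card_mul_sub_of_split hdet (z := z) (w := w)
      ((algebraMap F K).injective (by rw [← hadd, map_add, map_mul]))
      ((algebraMap F K).injective (by rw [← hmul, map_mul, map_mul]))
      (by rintro rfl; exact hζ1 (map_one _))
    push_cast [← @Nat.cast_inj ℤ] at hsum hcard ⊢
    linarith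
end

section
/- Let q be a prime power, let M = [[a,b],[c,d]] be an invertible 2×2 matrix over F_q, and suppose the least integer t ≥ 1 such that M^t is a scalar matrix satisfies t ≥ 3. Let L = { v ∈ F̄_q : v^q·(cv+d) = av + b and v ∉ F_{q^2} }. Then there is a unique κ ∈ {0, 1, -1} with κ ≡ -q (mod t), the cardinality of L equals q + κ, and in particular t divides q + κ. -/
open Polynomial in
/-- The solutions of `v ^ q * (c * v + d) = a * v + b` over an algebraically closed field in
which `q = 0`: there are as many as the degree of the equation. -/
lemma ncard_frobenius_mobius {K : Type*} [Field K] [IsAlgClosed K] {q : ℕ}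
    (hq0 : (q : K) = 0) {a b c d : K} (hdet : a * d - b * c ≠ 0) :
    {v : K | v ^ q * (c * v + d) = a * v + b}.Finite ∧
      {v : K | v ^ q * (c * v + d) = a * v + b}.ncard =
        (C c * X ^ (q + 1) + C d * X ^ q - C a * X - C b).natDegree := by
  classical
  set P : K[X] := C c * X ^ (q + 1) + C d * X ^ q - C a * X - C b with hP
  have heval (v : K) : P.eval v = v ^ q * (c * v + d) - (a * v + b) := by
    simp only [hP, eval_sub, eval_add, eval_mul, eval_C, eval_pow, eval_X]
    ring
  have hder (v : K) : P.derivative.eval v = c * v ^ q - a := by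
    simp [hP, derivative_X_pow, hq0]
  have hnr (v : K) (h : P.eval v = 0) : P.derivative.eval v ≠ 0 := by
    rw [heval] at h
    rw [hder]
    intro h'
    have h1 : d * v ^ q = b := by linear_combination h - v * h'
    exact hdet (by linear_combination c * h1 - d * h')
  have hP0 : P ≠ 0 := by
    intro h
    exact hnr 0 (by simp [h]) (by simp [h])
  have hset : {v : K | v ^ q * (c * v + d) = a * v + b} = ↑P.roots.toFinset := by
    ext v
    simp [hP0, heval, sub_eq_zero]
  have hnodup : P.roots.Nodup := by
    rw [Multiset.nodup_iff_count_le_one]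
    intro v
    rw [count_roots]
    by_contra! hlt
    have := (one_lt_rootMultiplicity_iff_isRoot hP0).1 hlt
    exact hnr v this.1 this.2
  rw [hset]
  refine ⟨Finset.finite_toSet _, ?_⟩
  rw [Set.ncard_coe_finset, Multiset.toFinset_card_of_nodup hnodup]
  exact (IsAlgClosed.splits P).natDegree_eq_card_roots.symm

/-- A `2 × 2` matrix with eigenvalues `x ≠ y` has scalar `n`-th power if `x ^ n = y ^ n`. -/
lemma Matrix.pow_eq_smul_one_of_pow_eq {K : Type*} [Field K] {a b c d x y : K} (hxy : x ≠ y)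
    (hs : x + y = a + d) (hp : x * y = a * d - b * c) {n : ℕ} {k : K}
    (hx : x ^ n = k) (hy : y ^ n = k) :
    !![a, b; c, d] ^ n = k • (1 : Matrix (Fin 2) (Fin 2) K) := by
  have key (m : ℕ) : (x - y) • !![a, b; c, d] ^ m =
      x ^ m • (!![a, b; c, d] - y • (1 : Matrix (Fin 2) (Fin 2) K)) -
        y ^ m • (!![a, b; c, d] - x • (1 : Matrix (Fin 2) (Fin 2) K)) := by
    induction m with
    | zero =>
      ext i j
      fin_cases i <;> fin_cases j <;> simp
    | succ m ih =>
      rw [pow_succ, ← smul_mul_assoc, ih]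
      have hd : d = x + y - a := by linear_combination -hs
      have hbc : b * c = a * d - x * y := by linear_combination hp
      subst hd
      ext i j
      fin_cases i <;> fin_cases j <;>
        simp [Matrix.mul_apply, Fin.sum_univ_two]
      · linear_combination (x ^ m - y ^ m) * hbc
      · ring
      · ring
      · linear_combination (x ^ m - y ^ m) * hbc
  have h := key n
  rw [hx, hy, ← smul_sub, sub_sub_sub_cancel_left, ← sub_smul, smul_comm] at h
  exact smul_right_injective _ (sub_ne_zero.2 hxy) h

/-- In characteristic `p`, a `2 × 2` matrix with a double eigenvalue `x` has scalar `p ^ n`-th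
power for `n ≠ 0`. -/
lemma Matrix.pow_char_pow_eq_smul_one {K : Type*} [Field K] (p : ℕ) [Fact p.Prime] [CharP K p]
    {n : ℕ} (hn : n ≠ 0) {a b c d x : K}
    (hs : x + x = a + d) (hp : x * x = a * d - b * c) :
    !![a, b; c, d] ^ p ^ n = x ^ p ^ n • (1 : Matrix (Fin 2) (Fin 2) K) := by
  set N : Matrix (Fin 2) (Fin 2) K := !![a, b; c, d] - x • 1 with hN
  have hN2 : N ^ 2 = 0 := by
    have hd : d = x + x - a := by linear_combination -hs
    have hbc : b * c = a * d - x * x := by linear_combination hp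
    subst hd
    rw [pow_two, hN]
    ext i j
    fin_cases i <;> fin_cases j <;>
      simp [Matrix.mul_apply, Fin.sum_univ_two]
    · linear_combination hbc
    · ring
    · ring
    · linear_combination hbc
  have hM : !![a, b; c, d] = N + x • 1 := by simp [hN]
  have h2 : 2 ≤ p ^ n := (Fact.out : p.Prime).two_le.trans (Nat.le_self_pow hn p)
  have hcomm : Commute N (x • 1) := (Commute.one_right N).smul_right x
  rw [hM, add_pow_char_pow_of_commute (p := p) (h := hcomm), pow_eq_zero_of_le h2 hN2, zero_add,
    smul_pow, one_pow]

/-- Over an algebraically closed field of characteristic `p`, let `M = [[a, b], [c, d]]` be fixed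
by the `q`-Frobenius, non-scalar and of nonzero trace. The number of solutions of
`v ^ q * (c * v + d) = a * v + b` with `v ^ q ^ 2 ≠ v` is `q + κ` with `κ ∈ {0, 1, -1}`,
and `M ^ (q + κ)` is scalar. -/
lemma exists_ncard_frobenius_mobius_diff {K : Type*} [Field K] [IsAlgClosed K] (p : ℕ)
    [Fact p.Prime] [CharP K p] {n : ℕ} (hn : n ≠ 0) {q : ℕ} (hq : q = p ^ n) {a b c d : K}
    (ha : a ^ q = a) (hb : b ^ q = b) (hc : c ^ q = c) (hd : d ^ q = d)
    (hdet : a * d - b * c ≠ 0) (htr : a + d ≠ 0) (hns : b ≠ 0 ∨ c ≠ 0 ∨ a ≠ d) :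
    ∃ m : ℕ, (m = q ∨ m = q + 1 ∨ m + 1 = q) ∧
      {v : K | v ^ q * (c * v + d) = a * v + b ∧ v ^ q ^ 2 ≠ v}.ncard = m ∧
      ∃ k : K, !![a, b; c, d] ^ m = k • (1 : Matrix (Fin 2) (Fin 2) K) := by
  have hq2 : 2 ≤ q := hq ▸ (Fact.out : p.Prime).two_le.trans (Nat.le_self_pow hn p)
  have hq0 : (q : K) = 0 := by simp [hq, hn]
  have hadd (x y : K) : (x + y) ^ q = x ^ q + y ^ q := by rw [hq, add_pow_char_pow]
  have hsub (x y : K) : (x - y) ^ q = x ^ q - y ^ q := by rw [hq, sub_pow_char_pow]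
  obtain ⟨hfin, hcard⟩ := ncard_frobenius_mobius hq0 hdet
  set S := {v : K | v ^ q * (c * v + d) = a * v + b} with hS
  set B := {v : K | v ^ q = v ∧ c * v ^ 2 + (d - a) * v - b = 0} with hB
  have hBS : B ⊆ S := by
    rintro v ⟨h1, h2⟩
    simp only [hS, Set.mem_ofPred_eq, h1]
    linear_combination h2
  have hL : {v : K | v ^ q * (c * v + d) = a * v + b ∧ v ^ q ^ 2 ≠ v} = S \ B := by
    ext v
    simp only [Set.mem_ofPred_eq, Set.mem_sdiff, hS, hB]
    refine and_congr_right fun h => not_congr ⟨fun h2 => ?_, fun h2 => ?_⟩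
    · have h3 := congrArg (· ^ q) h
      simp only [mul_pow, hadd, ha, hb, hc, hd, ← pow_mul, ← pow_two, h2] at h3
      have h4 : (a + d) * (v ^ q - v) = 0 := by linear_combination h - h3
      have h5 : v ^ q = v := sub_eq_zero.1 ((mul_eq_zero.1 h4).resolve_left htr)
      rw [h5] at h
      exact ⟨h5, by linear_combination h⟩
    · rw [pow_two, pow_mul, h2.1, h2.1]
  have hncard : {v : K | v ^ q * (c * v + d) = a * v + b ∧ v ^ q ^ 2 ≠ v}.ncard =
      S.ncard - B.ncard := by
    rw [hL, Set.ncard_sdiff hBS (hfin.subset hBS)]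
  rw [hncard]
  have hunit {x : K} (hx0 : x ≠ 0) (hx : x ^ q = x) : x ^ (q - 1) = 1 := by
    apply mul_right_cancel₀ hx0
    rw [← pow_succ, Nat.sub_add_cancel (by omega), hx, one_mul]
  by_cases hc0 : c = 0
  · subst hc0
    have had : a * d ≠ 0 := by simpa using hdet
    have hSq : S.ncard = q := by
      rw [hcard]
      have hd0 : d ≠ 0 := right_ne_zero_of_mul had
      rw [Polynomial.C_0, zero_mul, zero_add]
      compute_degree!
      · rwa [if_neg (by omega), if_neg (by omega), sub_zero, sub_zero]
      all_goals omega
    by_cases hadeq : a = d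
    · refine ⟨q, Or.inl rfl, ?_, a ^ p ^ n, ?_⟩
      · have : B = ∅ := by
          ext v
          have hb0 : b ≠ 0 := by simpa [hadeq] using hns
          simp [hB, hadeq, hb0]
        simp [this, hSq]
      · rw [hq]
        exact Matrix.pow_char_pow_eq_smul_one p hn (by rw [hadeq]) (by rw [hadeq]; ring)
    · have hda : d - a ≠ 0 := sub_ne_zero.2 (Ne.symm hadeq)
      refine ⟨q - 1, by omega, ?_, 1, ?_⟩
      · have : B = {b / (d - a)} := by
          ext v
          simp only [hB, Set.mem_ofPred_eq, Set.mem_singleton_iff]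
          constructor
          · rintro ⟨-, h⟩
            rw [eq_div_iff hda]
            linear_combination h
          · rintro rfl
            refine ⟨by rw [div_pow, hsub, ha, hb, hd], ?_⟩
            field_simp
            ring
        simp [this, hSq]
      · exact Matrix.pow_eq_smul_one_of_pow_eq hadeq rfl (by ring)
          (hunit (left_ne_zero_of_mul had) ha) (hunit (right_ne_zero_of_mul had) hd)
  · have hSq : S.ncard = q + 1 := by
      rw [hcard]
      compute_degree!
      rwa [if_neg (by omega), sub_zero]
    obtain ⟨v, hv⟩ : ∃ v : K, c * v ^ 2 + (d - a) * v - b = 0 := by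
      have hdeg : (Polynomial.C c * Polynomial.X ^ 2 + Polynomial.C (d - a) * Polynomial.X +
          Polynomial.C (-b)).degree ≠ 0 := by
        rw [Polynomial.degree_quadratic hc0]
        decide
      obtain ⟨v, hv⟩ := IsAlgClosed.exists_root _ hdeg
      refine ⟨v, ?_⟩
      simpa [Polynomial.IsRoot, ← sub_eq_add_neg] using hv
    obtain ⟨w, hw⟩ : ∃ w : K, c * (v + w) = a - d :=
      ⟨(a - d) / c - v, by field_simp; ring⟩
    have hfac (x : K) : c * x ^ 2 + (d - a) * x - b = c * ((x - v) * (x - w)) := by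
      linear_combination hv + (x - v) * hw
    have hroot (x : K) : c * x ^ 2 + (d - a) * x - b = 0 ↔ x = v ∨ x = w := by
      rw [hfac]
      simp [hc0, sub_eq_zero]
    have hBm (x : K) : x ∈ B ↔ x ^ q = x ∧ (x = v ∨ x = w) := by
      simp only [hB, Set.mem_ofPred_eq, hroot]
    have hfrob : v ^ q = v ∨ v ^ q = w := by
      rw [← hroot]
      have h := congrArg (· ^ q) hv
      simp only [hadd, hsub, mul_pow, ha, hb, hc, hd] at h
      rw [zero_pow (by omega)] at h
      linear_combination h
    have hfrobw : v ^ q + w ^ q = v + w := by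
      have h := congrArg (· ^ q) hw
      simp only [hadd, hsub, mul_pow, ha, hc, hd] at h
      exact mul_left_cancel₀ hc0 (h.trans hw.symm)
    have hs : (c * v + d) + (c * w + d) = a + d := by linear_combination hw
    have hp : (c * v + d) * (c * w + d) = a * d - b * c := by
      linear_combination (d + c * v) * hw - c * hv
    have hpow (x : K) : (c * x + d) ^ q = c * x ^ q + d := by rw [hadd, mul_pow, hc, hd]
    by_cases hvw : v = w
    · subst hvw
      have hvq : v ^ q = v := by simpa using hfrob
      refine ⟨q, Or.inl rfl, ?_, (c * v + d) ^ p ^ n, ?_⟩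
      · have : B = {v} := by
          ext x
          rw [hBm, or_self, Set.mem_singleton_iff]
          exact ⟨fun h => h.2, fun h => ⟨h ▸ hvq, h⟩⟩
        simp [this, hSq]
      · rw [hq]
        exact Matrix.pow_char_pow_eq_smul_one p hn hs hp
    · have hne : c * v + d ≠ c * w + d := by
        simpa [hc0] using hvw
      rcases hfrob with hvq | hvq
      · have hwq : w ^ q = w := by linear_combination hfrobw - hvq
        refine ⟨q - 1, by omega, ?_, 1, ?_⟩
        · have : B = {v, w} := by
            ext x
            rw [hBm, Set.mem_insert_iff, Set.mem_singleton_iff]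
            refine ⟨fun h => h.2, fun h => ⟨?_, h⟩⟩
            rcases h with rfl | rfl <;> assumption
          rw [this, hSq, Set.ncard_pair hvw]
          omega
        · refine Matrix.pow_eq_smul_one_of_pow_eq hne hs hp (hunit ?_ ?_) (hunit ?_ ?_)
          · exact left_ne_zero_of_mul (hp ▸ hdet)
          · rw [hpow, hvq]
          · exact right_ne_zero_of_mul (hp ▸ hdet)
          · rw [hpow, hwq]
      · have hwq : w ^ q = v := by linear_combination hfrobw - hvq
        refine ⟨q + 1, by omega, ?_, a * d - b * c, ?_⟩
        · have : B = ∅ := by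
            ext x
            rw [hBm, Set.mem_empty_iff_false, iff_false]
            rintro ⟨hx, rfl | rfl⟩
            · exact hvw (hx.symm.trans hvq)
            · exact hvw (hwq.symm.trans hx)
          simp [this, hSq]
        · refine Matrix.pow_eq_smul_one_of_pow_eq hne hs hp ?_ ?_
          · rw [pow_succ, hpow, hvq, ← hp, mul_comm]
          · rw [pow_succ, hpow, hwq, hp]

/-- If `t` is the order of an invertible `2 × 2` matrix `M` modulo scalars, then `t ∣ m` whenever
`M ^ m` is scalar. -/
lemma Matrix.dvd_of_pow_eq_smul_one_s7 {F : Type*} [Field F] {M : Matrix (Fin 2) (Fin 2) F}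
    (hdet : M.det ≠ 0) {t : ℕ} (ht : 0 < t)
    (hts : ∃ k : F, M ^ t = k • (1 : Matrix (Fin 2) (Fin 2) F))
    (htleast : ∀ m : ℕ, 1 ≤ m → (∃ k : F, M ^ m = k • (1 : Matrix (Fin 2) (Fin 2) F)) → t ≤ m)
    {m : ℕ} (hm : ∃ k : F, M ^ m = k • (1 : Matrix (Fin 2) (Fin 2) F)) : t ∣ m := by
  obtain ⟨k, hk⟩ := hts
  obtain ⟨l, hl⟩ := hm
  have hk0 : k ≠ 0 := by
    rintro rfl
    have h := congrArg Matrix.det hk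
    rw [zero_smul, Matrix.det_pow, Matrix.det_zero] at h
    exact hdet (pow_eq_zero_iff ht.ne' |>.1 h)
  by_contra hnd
  have hpos : 1 ≤ m % t := Nat.pos_of_ne_zero fun h => hnd (Nat.dvd_of_mod_eq_zero h)
  refine (Nat.mod_lt m ht).not_ge (htleast _ hpos ⟨(k ^ (m / t))⁻¹ * l, ?_⟩)
  have h : k ^ (m / t) • M ^ (m % t) = l • (1 : Matrix (Fin 2) (Fin 2) F) := by
    rw [← hl]
    conv_rhs => rw [← Nat.div_add_mod m t, pow_add, pow_mul, hk, smul_pow, one_pow,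
      smul_mul_assoc, one_mul]
  rw [mul_smul, ← h, inv_smul_smul₀ (pow_ne_zero _ hk0)]

/-- A matrix is scalar if it becomes scalar in a field extension. -/
lemma Matrix.exists_eq_smul_one_of_map {F K : Type*} [Field F] [Field K] (f : F →+* K)
    {M : Matrix (Fin 2) (Fin 2) F}
    (h : ∃ k : K, f.mapMatrix M = k • (1 : Matrix (Fin 2) (Fin 2) K)) :
    ∃ k : F, M = k • (1 : Matrix (Fin 2) (Fin 2) F) := by
  obtain ⟨k, hk⟩ := h
  have h00 : f (M 0 0) = k := by simpa using congrFun₂ hk 0 0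
  refine ⟨M 0 0, Matrix.map_injective (m := Fin 2) (n := Fin 2) f.injective ?_⟩
  change f.mapMatrix M = f.mapMatrix _
  rw [hk, ← h00]
  ext i j
  fin_cases i <;> fin_cases j <;> simp

/-- Let `γ = [[a,b],[c,d]] ∈ PGL_2(F_q)` have order `t ≥ 3` modulo scalars, and let
`L = {v ∈ F̄_q : v^q(cv+d) = av+b, v ∉ F_{q^2}}`. Then there is a unique
`κ ∈ {0,1,-1}` with `κ ≡ -q (mod t)`, `|L| = q + κ`, and `t ∣ q + κ`. -/
theorem stmt7 (F : Type*) [Field F] [Fintype F] (q : ℕ) (hq : Fintype.card F = q)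
    (a b c d : F) (hdet : a * d - b * c ≠ 0)
    (t : ℕ) (ht3 : 3 ≤ t)
    (hts : ∃ k : F, (!![a, b; c, d]) ^ t = k • (1 : Matrix (Fin 2) (Fin 2) F))
    (htleast : ∀ m : ℕ, 1 ≤ m →
      (∃ k : F, (!![a, b; c, d]) ^ m = k • (1 : Matrix (Fin 2) (Fin 2) F)) → t ≤ m) :
    ∃ κ : ℤ, (κ = 0 ∨ κ = 1 ∨ κ = -1) ∧ κ ≡ -(q : ℤ) [ZMOD (t : ℤ)] ∧
      (∀ κ' : ℤ, (κ' = 0 ∨ κ' = 1 ∨ κ' = -1) → κ' ≡ -(q : ℤ) [ZMOD (t : ℤ)] → κ' = κ) ∧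
      (Nat.card {v : AlgebraicClosure F //
          v ^ q * (algebraMap F (AlgebraicClosure F) c * v + algebraMap F (AlgebraicClosure F) d)
            = algebraMap F (AlgebraicClosure F) a * v + algebraMap F (AlgebraicClosure F) b ∧
          v ^ q ^ 2 ≠ v} : ℤ) = (q : ℤ) + κ ∧
      (t : ℤ) ∣ (q : ℤ) + κ := by
  have hdet' : (!![a, b; c, d] : Matrix (Fin 2) (Fin 2) F).det ≠ 0 := by
    rwa [Matrix.det_fin_two_of]
  let f := algebraMap F (AlgebraicClosure F)
  obtain ⟨p, hpchar⟩ := CharP.exists F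
  obtain ⟨n, hp, hcard⟩ := FiniteField.card F p
  have : Fact p.Prime := ⟨hp⟩
  have : CharP (AlgebraicClosure F) p := charP_of_injective_algebraMap f.injective p
  have hfix (x : F) : f x ^ q = f x := by rw [← map_pow, ← hq, FiniteField.pow_card]
  have htr : a + d ≠ 0 := by
    intro h
    have hle := htleast 2 one_le_two ⟨-(a * d - b * c), by
      have hd : d = -a := by linear_combination h
      subst hd
      rw [pow_two]
      ext i j
      fin_cases i <;> fin_cases j <;> simp [Matrix.mul_apply, Fin.sum_univ_two] <;> ring⟩
    omega
  have hns : b ≠ 0 ∨ c ≠ 0 ∨ a ≠ d := by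
    by_contra! h
    obtain ⟨rfl, rfl, rfl⟩ := h
    have hle := htleast 1 le_rfl ⟨a, by
      ext i j
      fin_cases i <;> fin_cases j <;> simp⟩
    omega
  obtain ⟨m, hm, hcardL, k, hk⟩ := exists_ncard_frobenius_mobius_diff p n.ne_zero
    (hq.symm.trans hcard) (hfix a) (hfix b) (hfix c) (hfix d)
    (by simpa only [← map_mul, ← map_sub] using (map_ne_zero f).2 hdet)
    (by simpa only [← map_add] using (map_ne_zero f).2 htr)
    (by simpa only [ne_eq, map_eq_zero, f.injective.eq_iff] using hns)
  have hdvd : t ∣ m := by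
    refine Matrix.dvd_of_pow_eq_smul_one_s7 hdet' (by omega) hts htleast
      (Matrix.exists_eq_smul_one_of_map f ⟨k, ?_⟩)
    rw [map_pow, ← hk]
    congr 1
    ext i j
    fin_cases i <;> fin_cases j <;> rfl
  have hdvd' : (t : ℤ) ∣ (q : ℤ) + ((m : ℤ) - q) := by
    simpa using Int.natCast_dvd_natCast.2 hdvd
  refine ⟨(m : ℤ) - q, by omega, ?_, ?_, ?_, hdvd'⟩
  · refine (Int.modEq_iff_dvd.2 ?_).symm
    convert hdvd' using 1
    abel
  · intro κ' hκ' hmod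
    have h1 : (t : ℤ) ∣ κ' - ((m : ℤ) - q) := by
      obtain ⟨x, hx⟩ := Int.modEq_iff_dvd.1 hmod.symm
      obtain ⟨y, hy⟩ := hdvd'
      exact ⟨x - y, by linear_combination hx - hy⟩
    refine sub_eq_zero.1 (Int.eq_zero_of_abs_lt_dvd h1 ?_)
    rw [abs_lt]
    omega
  · rw [add_sub_cancel, ← hcardL]
    rfl
end

section
/- Let q be an odd prime power. (a) Every τ ∈ F_q can be written as τ = (v + 1/v)^2/4 for some v ∈ F̄_q^× satisfying v^{2(q-1)} = 1 or v^{2(q+1)} = 1. (b) Moreover, if τ ∉ {0,1} and v ∈ F̄_q^× satisfies τ = (v+1/v)^2/4, set A = τ^{(q-1)/2} and B = (τ-1)^{(q-1)/2} (so A, B ∈ {1,-1}); then v^{q-AB} = A, i.e., if AB = 1 then v^{q-1} = A and if AB = -1 then v^{q+1} = A. -/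
/-- The image of `2 * v = (v + v⁻¹) + (v - v⁻¹)` under the Frobenius `x ↦ x ^ q`, when the two
summands are eigenvectors with eigenvalues `A` and `B`. -/
theorem two_mul_frobenius_eq {F K : Type*} [Field F] [Fintype F] [Field K] [Algebra F K]
    {v A B : K} (hA : (v + v⁻¹) ^ Fintype.card F = A * (v + v⁻¹))
    (hB : (v - v⁻¹) ^ Fintype.card F = B * (v - v⁻¹)) :
    2 * v ^ Fintype.card F = A * (v + v⁻¹) + B * (v - v⁻¹) := by
  have hadd := map_add (FiniteField.frobeniusAlgHom F K) v v⁻¹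
  have hsub := map_sub (FiniteField.frobeniusAlgHom F K) v v⁻¹
  simp only [FiniteField.coe_frobeniusAlgHom] at hadd hsub
  linear_combination hA + hB - hadd - hsub

theorem four_ne_zero_of_two_ne_zero {K : Type*} [Field K] (h2 : (2 : K) ≠ 0) : (4 : K) ≠ 0 := by
  rw [show (4 : K) = 2 ^ 2 by norm_num]
  exact pow_ne_zero 2 h2

theorem FiniteField.two_ne_zero_of_odd_card {F : Type*} (K : Type*) [Field F] [Fintype F]
    [Field K] [Algebra F K] (hodd : Odd (Fintype.card F)) : (2 : K) ≠ 0 := by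
  rw [← map_ofNat (algebraMap F K)]
  refine (map_ne_zero _).mpr (Ring.two_ne_zero fun h => ?_)
  have := FiniteField.even_card_of_char_two h
  have := Nat.odd_iff.mp hodd
  omega

/-- The quadratic residue symbol of a nonzero element is `1` or `-1`. -/
theorem FiniteField.pow_half_card_sub_one_eq {F : Type*} [Field F] [Fintype F]
    {m : ℕ} (hm : Fintype.card F = 2 * m + 1) {t : F} (ht : t ≠ 0) :
    t ^ m = 1 ∨ t ^ m = -1 := by
  rw [← sq_eq_one_iff, ← pow_mul, mul_comm]
  simpa [hm] using FiniteField.pow_card_sub_one_eq_one t ht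

/-- The two cases of `v ^ (q - A * B) = A`, where `A` and `B` are the quadratic residue symbols
of `τ = (v + v⁻¹) ^ 2 / 4` and `τ - 1`. -/
theorem FiniteField.pow_eq_of_eq_add_inv_sq_div_four {F K : Type*} [Field F] [Fintype F]
    [Field K] [Algebra F K] {m : ℕ} (hm : Fintype.card F = 2 * m + 1) {τ : F} {v : K}
    (h0 : τ ≠ 0) (hv : v ≠ 0) (h : algebraMap F K τ = (v + v⁻¹) ^ 2 / 4) :
    (τ ^ m * (τ - 1) ^ m = 1 → v ^ (2 * m) = algebraMap F K (τ ^ m)) ∧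
    (τ ^ m * (τ - 1) ^ m = -1 → v ^ (2 * m + 2) = algebraMap F K (τ ^ m)) := by
  have h2F : (2 : F) ≠ 0 := FiniteField.two_ne_zero_of_odd_card F ⟨m, hm⟩
  have h2 : (2 : K) ≠ 0 := FiniteField.two_ne_zero_of_odd_card K ⟨m, hm⟩
  have h4F : (4 : F) ^ m = 1 := by
    rw [show (4 : F) = 2 ^ 2 by norm_num, ← pow_mul]
    simpa [hm] using FiniteField.pow_card_sub_one_eq_one (2 : F) h2F
  have h4 : (4 : K) ^ m = 1 := by
    rw [← map_ofNat (algebraMap F K), ← map_pow, h4F, map_one]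
  have h40 : (4 : K) ≠ 0 := four_ne_zero_of_two_ne_zero h2
  have hadd : (v + v⁻¹) ^ 2 = 4 * algebraMap F K τ := by
    rw [h]
    field_simp
  have hsub : (v - v⁻¹) ^ 2 = 4 * algebraMap F K (τ - 1) := by
    rw [map_sub, map_one]
    linear_combination hadd - 4 * mul_inv_cancel₀ hv
  have hfrob := two_mul_frobenius_eq (F := F) (v := v)
    (A := algebraMap F K (τ ^ m)) (B := algebraMap F K ((τ - 1) ^ m))
    (by rw [hm, pow_succ, pow_mul, hadd, mul_pow, h4, one_mul, map_pow])
    (by rw [hm, pow_succ, pow_mul, hsub, mul_pow, h4, one_mul, map_pow])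
  rw [hm] at hfrob
  have hA := FiniteField.pow_half_card_sub_one_eq hm h0
  refine ⟨fun hAB => ?_, fun hAB => ?_⟩
  · have hB : (τ - 1) ^ m = τ ^ m := by
      rcases hA with hA | hA <;> grind
    rw [hB] at hfrob
    apply mul_left_cancel₀ (mul_ne_zero h2 hv)
    linear_combination hfrob
  · have hB : (τ - 1) ^ m = -τ ^ m := by
      rcases hA with hA | hA <;> grind
    rw [hB, map_neg] at hfrob
    apply mul_left_cancel₀ h2
    linear_combination v * hfrob + 2 * algebraMap F K (τ ^ m) * mul_inv_cancel₀ hv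

theorem IsAlgClosed.exists_eq_add_inv_sq_div_four {K : Type*} [Field K] [IsAlgClosed K]
    (h2 : (2 : K) ≠ 0) (t : K) : ∃ v : K, v ≠ 0 ∧ t = (v + v⁻¹) ^ 2 / 4 := by
  obtain ⟨a, ha⟩ := IsAlgClosed.exists_pow_nat_eq t two_pos
  obtain ⟨b, hb⟩ := IsAlgClosed.exists_pow_nat_eq (t - 1) two_pos
  have hinv : (a + b) * (a - b) = 1 := by linear_combination ha - hb
  have h40 : (4 : K) ≠ 0 := four_ne_zero_of_two_ne_zero h2
  refine ⟨a + b, left_ne_zero_of_mul_eq_one hinv, ?_⟩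
  rw [inv_eq_of_mul_eq_one_right hinv, eq_div_iff h40]
  linear_combination -4 * ha

/-- Klein-group theorem for odd `q`: every `τ ∈ F_q` is `(v+1/v)²/4` with
`v ∈ μ_{2(q-1)} ∪ μ_{2(q+1)}`; and if `τ ∉ {0,1}` then, with `A = τ^{(q-1)/2}` and
`B = (τ-1)^{(q-1)/2}` (both in `{1,-1}`), one has `v^{q-AB} = A`. -/
theorem stmt10 (F : Type*) [Field F] [Fintype F] (q : ℕ) (hq : Fintype.card F = q)
    (hodd : Odd q) :
    (∀ τ : F, ∃ v : AlgebraicClosure F, v ≠ 0 ∧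
        algebraMap F (AlgebraicClosure F) τ = (v + 1 / v) ^ 2 / 4 ∧
        (v ^ (2 * (q - 1)) = 1 ∨ v ^ (2 * (q + 1)) = 1)) ∧
    (∀ (τ : F) (v : AlgebraicClosure F), τ ≠ 0 → τ ≠ 1 → v ≠ 0 →
        algebraMap F (AlgebraicClosure F) τ = (v + 1 / v) ^ 2 / 4 →
        (τ ^ ((q - 1) / 2) = 1 ∨ τ ^ ((q - 1) / 2) = -1) ∧
        ((τ - 1) ^ ((q - 1) / 2) = 1 ∨ (τ - 1) ^ ((q - 1) / 2) = -1) ∧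
        (τ ^ ((q - 1) / 2) * (τ - 1) ^ ((q - 1) / 2) = 1 →
            v ^ (q - 1) = algebraMap F (AlgebraicClosure F) (τ ^ ((q - 1) / 2))) ∧
        (τ ^ ((q - 1) / 2) * (τ - 1) ^ ((q - 1) / 2) = -1 →
            v ^ (q + 1) = algebraMap F (AlgebraicClosure F) (τ ^ ((q - 1) / 2)))) := by
  subst hq
  obtain ⟨m, hm⟩ := hodd
  have h2 := FiniteField.two_ne_zero_of_odd_card (AlgebraicClosure F) ⟨m, hm⟩
  have h40 := four_ne_zero_of_two_ne_zero h2
  have hsub : Fintype.card F - 1 = 2 * m := by omega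
  have hhalf : (Fintype.card F - 1) / 2 = m := by omega
  have hadd : Fintype.card F + 1 = 2 * m + 2 := by omega
  simp only [hhalf]
  simp only [hsub, hadd, one_div]
  have hsign {t : F} (ht : t ≠ 0) := FiniteField.pow_half_card_sub_one_eq hm ht
  refine ⟨fun τ => ?_, fun τ v h0 h1 hv h => ⟨hsign h0, hsign (sub_ne_zero.mpr h1),
    FiniteField.pow_eq_of_eq_add_inv_sq_div_four hm h0 hv h⟩⟩
  rcases eq_or_ne τ 1 with rfl | h1
  · refine ⟨1, one_ne_zero, ?_, Or.inl (one_pow _)⟩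
    rw [map_one, eq_div_iff h40]
    norm_num
  obtain ⟨v, hv, h⟩ :=
    IsAlgClosed.exists_eq_add_inv_sq_div_four h2 (algebraMap F (AlgebraicClosure F) τ)
  refine ⟨v, hv, h, ?_⟩
  rcases eq_or_ne τ 0 with rfl | h0
  · rw [map_zero, eq_comm, div_eq_zero_iff, or_iff_left h40, sq_eq_zero_iff] at h
    have hv2 : v ^ 2 = -1 := by linear_combination v * h - mul_inv_cancel₀ hv
    left
    rw [show 2 * (2 * m) = 2 * 2 * m by ring, pow_mul, pow_mul, hv2]
    norm_num
  obtain ⟨hpos, hneg⟩ := FiniteField.pow_eq_of_eq_add_inv_sq_div_four hm h0 hv h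
  have hA : (τ ^ m) ^ 2 = 1 := by
    rcases hsign h0 with h | h <;> simp [h]
  have hAB : τ ^ m * (τ - 1) ^ m = 1 ∨ τ ^ m * (τ - 1) ^ m = -1 := by
    rw [← mul_pow]
    exact hsign (mul_ne_zero h0 (sub_ne_zero.mpr h1))
  refine hAB.imp (fun hAB => ?_) (fun hAB => ?_)
  · rw [mul_comm, pow_mul, hpos hAB, ← map_pow, hA, map_one]
  · rw [mul_comm, pow_mul, hneg hAB, ← map_pow, hA, map_one]
end

section
/- Let P be a prime power and q = P^e. Let W ⊆ F_q be an F_P-vector subspace of dimension d, let Q_W(x) = ∏_{w ∈ W} (x - w) ∈ F_q[x], and let Y = { Q_W(a) : a ∈ F_q } be the image of F_q under Q_W. Then Y is an F_P-vector subspace of F_q of dimension e - d; the image of F_q under Q_Y(x) = ∏_{y ∈ Y} (x - y) equals W; and as polynomials, Q_Y(Q_W(x)) = Q_W(Q_Y(x)) = x^q - x. -/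
open Polynomial

/-- For a finite subset `S` of a finite field, the polynomial `∏_{s ∈ S} (x - s)`. -/
noncomputable def vanishingPoly {K : Type*} [Field K] [Finite K] (S : Set K) : K[X] :=
  ∏ y ∈ (Set.toFinite S).toFinset, (X - C y)

section VanishingPoly

variable {K : Type*} [Field K] [Finite K]

lemma vanishingPoly_monic (S : Set K) : (vanishingPoly S).Monic :=
  monic_prod_of_monic _ _ fun y _ => monic_X_sub_C y

lemma natDegree_vanishingPoly (S : Set K) : (vanishingPoly S).natDegree = Nat.card S := by
  rw [vanishingPoly, natDegree_prod_of_monic _ _ fun y _ => monic_X_sub_C y]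
  simp [Nat.card_coe_set_eq, Set.ncard_eq_toFinset_card S (Set.toFinite S)]

lemma eval_vanishingPoly_eq_zero {S : Set K} {x : K} :
    (vanishingPoly S).eval x = 0 ↔ x ∈ S := by
  simp [vanishingPoly, eval_prod, Finset.prod_eq_zero_iff, sub_eq_zero]

lemma aeval_vanishingPoly {R : Type*} [CommRing R] [Algebra K R] (S : Set K) (a : R) :
    aeval a (vanishingPoly S) = ∏ y ∈ (Set.toFinite S).toFinset, (a - algebraMap K R y) := by
  simp [vanishingPoly, map_prod]

lemma aeval_vanishingPoly_add_algebraMap {R : Type*} [CommRing R] [Algebra K R]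
    (G : AddSubgroup K) (a : R) {w : K} (hw : w ∈ G) :
    aeval (algebraMap K R w + a) (vanishingPoly (G : Set K)) =
      aeval a (vanishingPoly (G : Set K)) := by
  rw [aeval_vanishingPoly, aeval_vanishingPoly]
  refine Finset.prod_bij' (fun y _ => y - w) (fun y _ => y + w) ?_ ?_ ?_ ?_ ?_
  · intro y hy
    simpa using G.sub_mem (by simpa using hy) hw
  · intro y hy
    simpa using G.add_mem (by simpa using hy) hw
  · simp
  · simp
  · intro y _
    rw [map_sub]
    ring

/-- The vanishing polynomial of an additive subgroup is additive over every domain containing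
the field. -/
lemma aeval_vanishingPoly_add {R : Type*} [CommRing R] [IsDomain R] [Algebra K R]
    (G : AddSubgroup K) (a b : R) :
    aeval (a + b) (vanishingPoly (G : Set K)) =
      aeval a (vanishingPoly (G : Set K)) + aeval b (vanishingPoly (G : Set K)) := by
  classical
  set Q := vanishingPoly (G : Set K) with hQ
  set q : R[X] := Q.map (algebraMap K R) with hq
  have hm : q.Monic := (vanishingPoly_monic _).map _
  have hqd : q.natDegree = Nat.card (G : Set K) := by
    rw [hq, (vanishingPoly_monic _).natDegree_map, natDegree_vanishingPoly]
  have hpos : 0 < Nat.card (G : Set K) := Nat.card_pos (α := G)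
  have hdeg : (q.comp (X + C b) - q - C (aeval b Q)).degree < (Nat.card (G : Set K) : ℕ) := by
    have hmc : (q.comp (X + C b)).Monic := hm.comp_X_add_C b
    have hdc : (q.comp (X + C b)).degree = q.degree := by
      rw [degree_eq_natDegree hmc.ne_zero, degree_eq_natDegree hm.ne_zero, natDegree_comp]
      simp
    have hdq : q.degree = (Nat.card (G : Set K) : ℕ) := by
      rw [degree_eq_natDegree hm.ne_zero, hqd]
    refine (degree_sub_le _ _).trans_lt (max_lt ?_ ?_)
    · rw [← hdq, ← hdc]
      exact degree_sub_lt_left hdc hmc.ne_zero (by rw [hmc.leadingCoeff, hm.leadingCoeff])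
    · exact degree_C_le.trans_lt (by exact_mod_cast hpos)
  have hinj : Function.Injective (algebraMap K R) := (algebraMap K R).injective
  have hzero : q.comp (X + C b) - q - C (aeval b Q) = 0 := by
    refine eq_zero_of_degree_lt_of_eval_finset_eq_zero
      ((Set.toFinite (G : Set K)).toFinset.image (algebraMap K R)) ?_ ?_
    · rw [Finset.card_image_of_injective _ hinj,
        ← Set.ncard_eq_toFinset_card (G : Set K) (Set.toFinite _), ← Nat.card_coe_set_eq]
      exact hdeg
    · intro x hx
      obtain ⟨w, hw, rfl⟩ := Finset.mem_image.1 hx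
      have hw' : w ∈ G := by simpa using hw
      have h0 : Q.eval w = 0 := eval_vanishingPoly_eq_zero.2 hw'
      have h1 := aeval_vanishingPoly_add_algebraMap G b hw'
      simp only [eval_sub, eval_comp, eval_add, eval_X, eval_C, hq, eval_map_algebraMap,
        aeval_algebraMap_apply, coe_aeval_eq_eval, h0, map_zero]
      rw [h1]
      simp [hQ]
  have h := congrArg (eval a) hzero
  simp only [eval_sub, eval_comp, eval_add, eval_X, eval_C, hq, eval_map_algebraMap,
    eval_zero] at h
  linear_combination h

end VanishingPoly

section Submodule

variable {F K : Type*} [Field F] [Field K] [Finite K] [Algebra F K]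

lemma eval_vanishingPoly_smul (W : Submodule F K) (c : F) (x : K) :
    (vanishingPoly (W : Set K)).eval (c • x) = c • (vanishingPoly (W : Set K)).eval x := by
  have : Finite F := Finite.of_injective _ (algebraMap F K).injective
  have := Fintype.ofFinite F
  by_cases hc : c = 0
  · subst hc
    simpa using eval_vanishingPoly_eq_zero.2 W.zero_mem
  have hpow : c ^ Nat.card (W : Set K) = c := by
    have h : Nat.card (W : Set K) = Fintype.card F ^ Module.finrank F W := by
      rw [← Nat.card_eq_fintype_card]
      exact Module.natCard_eq_pow_finrank (K := F) (V := W)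
    rw [h, FiniteField.pow_card_pow]
  have hcard : (Set.toFinite (W : Set K)).toFinset.card = Nat.card (W : Set K) := by
    rw [Nat.card_coe_set_eq, ← Set.ncard_eq_toFinset_card]
  nth_rw 2 [← hpow]
  rw [← hcard]
  simp only [vanishingPoly, eval_prod, eval_sub, eval_X, eval_C]
  rw [← Finset.prod_const, ← Finset.prod_smul]
  refine Finset.prod_bij' (fun y _ => c⁻¹ • y) (fun y _ => c • y) ?_ ?_ ?_ ?_ ?_
  · intro y hy
    simpa using W.smul_mem c⁻¹ (by simpa using hy)
  · intro y hy
    simpa using W.smul_mem c (by simpa using hy)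
  · intro y _
    exact smul_inv_smul₀ hc y
  · intro y _
    exact inv_smul_smul₀ hc y
  · intro y _
    rw [smul_sub, smul_inv_smul₀ hc]

/-- Evaluation of the vanishing polynomial of a subspace, as a linear map. -/
noncomputable def vanishingMap (W : Submodule F K) : K →ₗ[F] K where
  toFun x := (vanishingPoly (W : Set K)).eval x
  map_add' x y := by simpa using aeval_vanishingPoly_add W.toAddSubgroup x y
  map_smul' c x := eval_vanishingPoly_smul W c x

lemma vanishingMap_apply (W : Submodule F K) (x : K) :
    vanishingMap W x = (vanishingPoly (W : Set K)).eval x := rfl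

lemma ker_vanishingMap (W : Submodule F K) : LinearMap.ker (vanishingMap W) = W := by
  ext x
  exact eval_vanishingPoly_eq_zero

lemma finrank_range_vanishingMap_add (W : Submodule F K) :
    Module.finrank F (LinearMap.range (vanishingMap W)) + Module.finrank F W =
      Module.finrank F K := by
  have : Module.Finite F K := .of_finite
  have h := (vanishingMap W).finrank_range_add_finrank_ker
  rwa [ker_vanishingMap] at h

lemma vanishingPoly_range_comp (W : Submodule F K) :
    (vanishingPoly (LinearMap.range (vanishingMap W) : Set K)).comp (vanishingPoly (W : Set K)) =
      X ^ Nat.card K - X := by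
  have := Fintype.ofFinite K
  set Y := LinearMap.range (vanishingMap W)
  have hW : (vanishingPoly (W : Set K)).natDegree ≠ 0 := by
    rw [natDegree_vanishingPoly]
    exact (Nat.card_pos (α := W)).ne'
  have hm : ((vanishingPoly (Y : Set K)).comp (vanishingPoly (W : Set K))).Monic :=
    (vanishingPoly_monic _).comp (vanishingPoly_monic _) hW
  have hcard : Nat.card (Y : Set K) * Nat.card (W : Set K) = Nat.card K := by
    have : Module.Finite F K := .of_finite
    have h1 : Nat.card (Y : Set K) = _ := Module.natCard_eq_pow_finrank (K := F) (V := Y)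
    have h2 : Nat.card (W : Set K) = _ := Module.natCard_eq_pow_finrank (K := F) (V := W)
    rw [h1, h2, Module.natCard_eq_pow_finrank (K := F) (V := K), ← pow_add,
      finrank_range_vanishingMap_add]
  have hd : ((vanishingPoly (Y : Set K)).comp (vanishingPoly (W : Set K))).degree =
      (Nat.card K : ℕ) := by
    rw [degree_eq_natDegree hm.ne_zero, natDegree_comp, natDegree_vanishingPoly,
      natDegree_vanishingPoly, hcard]
  have hlt : (X : K[X]).degree < (Nat.card K : ℕ) := by
    rw [degree_X]
    exact_mod_cast Finite.one_lt_card
  have hm' : (X ^ Nat.card K - X : K[X]).Monic := monic_X_pow_sub hlt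
  have hd' : (X ^ Nat.card K - X : K[X]).degree = (Nat.card K : ℕ) := by
    rw [degree_sub_eq_left_of_degree_lt (by rwa [degree_X_pow]), degree_X_pow]
  refine eq_of_degree_sub_lt_of_eval_finset_eq Finset.univ ?_ ?_
  · rw [Finset.card_univ, ← Nat.card_eq_fintype_card, ← hd]
    exact degree_sub_lt_left (hd.trans hd'.symm) hm.ne_zero
      (by rw [hm.leadingCoeff, hm'.leadingCoeff])
  · intro x _
    have h0 : (vanishingPoly (Y : Set K)).eval ((vanishingPoly (W : Set K)).eval x) = 0 :=
      eval_vanishingPoly_eq_zero.2 ⟨x, rfl⟩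
    rw [eval_comp, h0]
    simp [Nat.card_eq_fintype_card, FiniteField.pow_card]

lemma vanishingPoly_comp_range (W : Submodule F K) :
    (vanishingPoly (W : Set K)).comp (vanishingPoly (LinearMap.range (vanishingMap W) : Set K)) =
      X ^ Nat.card K - X := by
  have := Fintype.ofFinite K
  set Q := vanishingPoly (W : Set K)
  set R := vanishingPoly (LinearMap.range (vanishingMap W) : Set K)
  have hW : Q.natDegree ≠ 0 := by
    rw [natDegree_vanishingPoly]
    exact (Nat.card_pos (α := W)).ne'
  have hadd : Q.comp (X ^ Nat.card K) = Q.comp (X ^ Nat.card K - X) + Q := by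
    have h := aeval_vanishingPoly_add W.toAddSubgroup (X ^ Nat.card K - X : K[X]) X
    simpa [comp_eq_aeval] using h
  have hfrob : Q.comp (X ^ Nat.card K) = Q ^ Nat.card K := by
    rw [Nat.card_eq_fintype_card, ← FiniteField.expand_card Q, expand_eq_comp_X_pow]
  have hcomp : (Q.comp R - (X ^ Nat.card K - X)).comp Q = 0 := by
    rw [sub_comp, comp_assoc, vanishingPoly_range_comp, sub_comp, X_pow_comp, X_comp, ← hfrob,
      hadd]
    ring
  rcases comp_eq_zero_iff.1 hcomp with h | ⟨_, h⟩
  · exact sub_eq_zero.1 h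
  · exact absurd (by rw [h, natDegree_C]) hW

lemma range_vanishingMap_range (W : Submodule F K) :
    LinearMap.range (vanishingMap (LinearMap.range (vanishingMap W))) = W := by
  have := Fintype.ofFinite K
  have : Module.Finite F K := .of_finite
  refine Submodule.eq_of_le_of_finrank_eq ?_ ?_
  · rintro _ ⟨x, rfl⟩
    refine eval_vanishingPoly_eq_zero.1 ?_
    rw [vanishingMap_apply, ← eval_comp, vanishingPoly_comp_range]
    simp [Nat.card_eq_fintype_card, FiniteField.pow_card]
  · have h1 := finrank_range_vanishingMap_add W
    have h2 := finrank_range_vanishingMap_add (LinearMap.range (vanishingMap W))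
    omega

end Submodule

/-- Reciprocity for additive polynomials: if `W ⊆ F_q` (`q = P^e`) is a `d`-dimensional
`F_P`-subspace, `Q_W(x) = ∏_{w ∈ W}(x-w)` and `Y = Q_W(F_q)`, then `Y` is an
`F_P`-subspace of dimension `e - d`, `Q_Y(F_q) = W`, and
`Q_Y ∘ Q_W = Q_W ∘ Q_Y = x^q - x`. -/
theorem stmt11 (P e d : ℕ) (F K : Type*) [Field F] [Fintype F] [Field K] [Fintype K]
    [Algebra F K] (hP : Fintype.card F = P) (hq : Fintype.card K = P ^ e)
    (W : Submodule F K) (hd : Module.finrank F W = d) :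
    (∃ V : Submodule F K,
        (V : Set K) = Set.range (fun x : K => (vanishingPoly (W : Set K)).eval x) ∧
        Module.finrank F V = e - d) ∧
    Set.range (fun x : K =>
        (vanishingPoly (Set.range fun y : K => (vanishingPoly (W : Set K)).eval y)).eval x)
      = (W : Set K) ∧
    (vanishingPoly (Set.range fun y : K => (vanishingPoly (W : Set K)).eval y)).comp
        (vanishingPoly (W : Set K)) = X ^ P ^ e - X ∧
    (vanishingPoly (W : Set K)).comp
        (vanishingPoly (Set.range fun y : K => (vanishingPoly (W : Set K)).eval y))
      = X ^ P ^ e - X := by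
  have hrange : (Set.range fun y : K => (vanishingPoly (W : Set K)).eval y) =
      (LinearMap.range (vanishingMap W) : Set K) := rfl
  have hcard : P ^ e = Nat.card K := by rw [Nat.card_eq_fintype_card, hq]
  have he : Module.finrank F K = e := by
    have h := Module.card_eq_pow_finrank (K := F) (V := K)
    rw [hq, hP] at h
    exact (Nat.pow_right_injective (hP ▸ Fintype.one_lt_card (α := F)) h).symm
  rw [hrange, hcard]
  refine ⟨⟨LinearMap.range (vanishingMap W), rfl, ?_⟩, ?_, vanishingPoly_range_comp W,
    vanishingPoly_comp_range W⟩
  · have h := finrank_range_vanishingMap_add W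
    omega
  · exact congrArg (fun V : Submodule F K => (V : Set K)) (range_vanishingMap_range W)
end

section
/- Let P be a prime power, q = P^e, and c ∈ F_q^×. Let τ ∈ F_q and let v ∈ F̄_q satisfy v^P - c^{P-1}·v = τ. Then v^q - v = c · Tr_{F_q/F_P}(τ/c^P), where Tr_{F_q/F_P} is the field trace from F_q to F_P. -/
theorem pow_sub_self_eq_sum_of_expChar_pow {R : Type*} [CommRing R] (p m : ℕ) [ExpChar R p]
    (w t : R) (h : w ^ p ^ m - w = t) (n : ℕ) :
    w ^ (p ^ m) ^ n - w = ∑ i ∈ Finset.range n, t ^ (p ^ m) ^ i := by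
  induction n with
  | zero => simp
  | succ n ih =>
    have h1 : t ^ (p ^ m) ^ n = w ^ (p ^ m) ^ (n + 1) - w ^ (p ^ m) ^ n := by
      rw [← h, ← pow_mul, sub_pow_expChar_pow, ← pow_mul, ← pow_add, ← pow_mul, mul_add_one,
        add_comm m]
    rw [Finset.sum_range_succ, ← ih, h1]
    ring

/-- If `c ∈ F_q^×` (`q = P^e`), `τ ∈ F_q`, and `v` in the algebraic closure satisfies
`v^P - c^{P-1}v = τ`, then `v^q - v = c · Tr_{F_q/F_P}(τ/c^P)`. -/
theorem stmt14 (P e : ℕ) (F K : Type*) [Field F] [Fintype F] [Field K] [Fintype K]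
    [Algebra F K] (hP : Fintype.card F = P) (hq : Fintype.card K = P ^ e)
    (c : K) (hc : c ≠ 0) (τ : K) (v : AlgebraicClosure K)
    (hv : v ^ P - algebraMap K (AlgebraicClosure K) (c ^ (P - 1)) * v
        = algebraMap K (AlgebraicClosure K) τ) :
    v ^ P ^ e - v = algebraMap K (AlgebraicClosure K)
        (c * ∑ i ∈ Finset.range e, (τ / c ^ P) ^ P ^ i) := by
  obtain ⟨p, hchar⟩ := CharP.exists F
  obtain ⟨m, hp, hm⟩ := FiniteField.card F p
  have : CharP K p := charP_of_injective_algebraMap (algebraMap F K).injective p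
  have : CharP (AlgebraicClosure K) p :=
    charP_of_injective_algebraMap (algebraMap K (AlgebraicClosure K)).injective p
  have : ExpChar (AlgebraicClosure K) p := .prime hp
  have hPm : P = p ^ (m : ℕ) := hP.symm.trans hm
  have hP0 : P ≠ 0 := hP ▸ Fintype.card_ne_zero
  have hcq : c ^ P ^ e = c := hq ▸ FiniteField.pow_card c
  set f := algebraMap K (AlgebraicClosure K)
  have hfc : f c ≠ 0 := by simpa using hc
  have hw : (v / f c) ^ P - v / f c = f (τ / c ^ P) := by
    rw [map_div₀, ← hv, map_pow, map_pow, div_pow, sub_div, ← pow_sub_one_mul hP0 (f c),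
      mul_div_mul_left _ _ (pow_ne_zero _ hfc)]
  have key := pow_sub_self_eq_sum_of_expChar_pow p m (v / f c) _ (hPm ▸ hw) e
  rw [← hPm, div_pow, ← map_pow f c, hcq, ← sub_div, div_eq_iff hfc] at key
  rw [key, map_mul, map_sum, mul_comm]
  simp only [map_pow]
end

section
/- Let q = 3^n, let τ ∈ F_q with τ ≠ 0, and let v ∈ F̄_q satisfy v^3 - 3v + 1 = τ·v·(v-1). Then v ∉ {0,1}, and with ℓ = Tr_{F_q/F_3}(1/τ) ∈ F_3: if ℓ = 0 then v^q = v; if ℓ = 1 then v^q = (v-1)/v; and if ℓ = 2 then v^q = 1/(1-v) (in particular v ≠ 1 makes this well defined). -/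
/-- Iterating the Artin–Schreier relation `w ^ p = w - s`. -/
theorem pow_char_pow_eq_sub_sum {K : Type*} [CommRing K] (p : ℕ) [Fact p.Prime] [CharP K p]
    {w s : K} (h : w ^ p = w - s) (k : ℕ) :
    w ^ p ^ k = w - ∑ i ∈ Finset.range k, s ^ p ^ i := by
  induction k with
  | zero => simp
  | succ k ih =>
    rw [pow_succ', pow_mul, h, sub_pow_char_pow, ih, Finset.sum_range_succ]
    ring

/-- In characteristic 3, `w = 1 / (v + 1)` turns the cubic `v³ - 3v + 1 = t v (v - 1)` into the
Artin–Schreier equation `w³ = w - 1 / t`. -/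
theorem inv_add_one_pow_three {K : Type*} [Field K] [CharP K 3] {t v : K} (ht : t ≠ 0)
    (hv : v ^ 3 - 3 * v + 1 = t * v * (v - 1)) (hu : v + 1 ≠ 0) :
    (v + 1)⁻¹ ^ 3 = (v + 1)⁻¹ - 1 / t := by
  have h3 : (3 : K) = 0 := by exact_mod_cast CharP.cast_eq_zero K 3
  field_simp
  linear_combination hv + (v ^ 2 + 2 * v - t * v) * h3

/-- Characteristic-3 order-3 invariant: for `q = 3^n`, `τ ∈ F_q^×`, and `v` in the algebraic
closure with `v³ - 3v + 1 = τ·v·(v-1)`, one has `v ∉ {0,1}` and, with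
`ℓ = Tr_{F_q/F_3}(1/τ)`: `ℓ = 0 → v^q = v`, `ℓ = 1 → v^q = (v-1)/v`,
`ℓ = 2 → v^q = 1/(1-v)`. -/
theorem stmt15 (n : ℕ) (F : Type*) [Field F] [Fintype F] (hq : Fintype.card F = 3 ^ n)
    (τ : F) (hτ : τ ≠ 0) (v : AlgebraicClosure F)
    (hv : v ^ 3 - 3 * v + 1 = algebraMap F (AlgebraicClosure F) τ * v * (v - 1)) :
    v ≠ 0 ∧ v ≠ 1 ∧
    (∑ i ∈ Finset.range n, (1 / τ) ^ 3 ^ i = 0 → v ^ 3 ^ n = v) ∧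
    (∑ i ∈ Finset.range n, (1 / τ) ^ 3 ^ i = 1 → v ^ 3 ^ n = (v - 1) / v) ∧
    (∑ i ∈ Finset.range n, (1 / τ) ^ 3 ^ i = 2 → v ^ 3 ^ n = 1 / (1 - v)) := by
  have : Fact (Nat.Prime 3) := ⟨Nat.prime_three⟩
  have : CharP F 3 := charP_of_card_eq_prime_pow hq
  have : CharP (AlgebraicClosure F) 3 :=
    charP_of_injective_algebraMap (algebraMap F (AlgebraicClosure F)).injective 3
  have h3 : (3 : AlgebraicClosure F) = 0 := by
    exact_mod_cast CharP.cast_eq_zero (AlgebraicClosure F) 3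
  have ht : algebraMap F (AlgebraicClosure F) τ ≠ 0 := by simpa using hτ
  have hv0 : v ≠ 0 := by
    rintro rfl
    simp at hv
  have hv1 : v - 1 ≠ 0 := by
    intro h
    rw [sub_eq_zero] at h
    subst h
    exact one_ne_zero (α := AlgebraicClosure F) (by linear_combination -hv)
  have hu : v + 1 ≠ 0 := by
    intro h
    obtain rfl : v = -1 := eq_neg_of_add_eq_zero_left h
    exact ht (by linear_combination hv + (algebraMap F (AlgebraicClosure F) τ - 1) * h3)
  have hw := pow_char_pow_eq_sub_sum 3 (inv_add_one_pow_three ht hv hu) n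
  have hsum : ∑ i ∈ Finset.range n, (1 / algebraMap F (AlgebraicClosure F) τ) ^ 3 ^ i =
      algebraMap F (AlgebraicClosure F) (∑ i ∈ Finset.range n, (1 / τ) ^ 3 ^ i) := by
    simp
  rw [hsum, inv_pow, add_pow_char_pow, one_pow] at hw
  have hU : v ^ 3 ^ n + 1 ≠ 0 := by
    have h := pow_ne_zero (3 ^ n) hu
    rwa [add_pow_char_pow, one_pow] at h
  refine ⟨hv0, sub_ne_zero.mp hv1, fun h => ?_, fun h => ?_, fun h => ?_⟩ <;>
    rw [h] at hw
  · rw [map_zero, sub_zero] at hw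
    exact add_right_cancel (inv_injective hw)
  · rw [map_one] at hw
    field_simp at hw ⊢
    generalize v ^ 3 ^ n = y at hw ⊢
    linear_combination hw - v * h3
  · have hv1' : 1 - v ≠ 0 := by rwa [← neg_sub, neg_ne_zero]
    rw [map_ofNat] at hw
    field_simp at hw ⊢
    generalize v ^ 3 ^ n = y at hw ⊢
    linear_combination hw - (1 + y * v + v) * h3
end

section
/- Let q be a prime power with 3 ∤ q, let ω ∈ F̄_q be a primitive cube root of unity, and let τ ∈ F_q satisfy τ^2 - 3τ + 9 ≠ 0 (equivalently (τ+3ω)(τ+3ω²) ≠ 0). Let v ∈ F̄_q satisfy v^3 - 3v + 1 = τ·v·(v-1), and set χ = ((τ+3ω²)/(τ+3ω))^{(q²-1)/3}. Then χ ∈ {1, ω, ω²}, and: if χ = 1 then v^q = v; if χ = ω then v^q = (v-1)/v; and if χ = ω² then v^q = 1/(1-v). -/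
/-- The fixed points of `v ↦ 1 - 1/v` are `-ω` and `-ω²`, and the cube of the coordinate
`(v+ω²)/(v+ω)` sending them to `∞` and `0` depends only on `τ`. -/
theorem cube_fixedPoint_coordinate {K : Type*} [Field K] {ω t v : K} (hω : ω ^ 2 + ω + 1 = 0)
    (hb : t + 3 * ω ≠ 0) (ha : t + 3 * ω ^ 2 ≠ 0)
    (hv : v ^ 3 - 3 * v + 1 = t * v * (v - 1)) :
    v + ω ≠ 0 ∧ v + ω ^ 2 ≠ 0 ∧
      ((v + ω ^ 2) / (v + ω)) ^ 3 = (t + 3 * ω ^ 2) / (t + 3 * ω) := by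
  have hv0 : v ≠ 0 := by
    rintro rfl
    simp at hv
  have hv1 : v - 1 ≠ 0 := by
    intro h
    obtain rfl : v = 1 := by linear_combination h
    exact one_ne_zero (α := K) (by linear_combination -hv)
  have hB : (v + ω) ^ 3 = (t + 3 * ω) * (v * (v - 1)) := by
    linear_combination hv + (3 * v + ω - 1) * hω
  have hA : (v + ω ^ 2) ^ 3 = (t + 3 * ω ^ 2) * (v * (v - 1)) := by
    linear_combination hv + (3 * v * (ω ^ 2 - ω + 1) + (ω - 1) * (ω ^ 3 + 1)) * hω
  have hB0 : v + ω ≠ 0 := by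
    intro h
    rw [h, zero_pow three_ne_zero] at hB
    exact mul_ne_zero hb (mul_ne_zero hv0 hv1) hB.symm
  have hA0 : v + ω ^ 2 ≠ 0 := by
    intro h
    rw [h, zero_pow three_ne_zero] at hA
    exact mul_ne_zero ha (mul_ne_zero hv0 hv1) hA.symm
  refine ⟨hB0, hA0, ?_⟩
  rw [div_pow, hA, hB, mul_div_mul_right _ _ (mul_ne_zero hv0 hv1)]

theorem three_ne_zero_of_not_dvd_card {F : Type*} [Field F] [Fintype F]
    (h : ¬ 3 ∣ Fintype.card F) : (3 : F) ≠ 0 := by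
  intro h0
  have hc : (Fintype.card F : F) = 0 := FiniteField.cast_card_eq_zero F
  rw [← Nat.div_add_mod (Fintype.card F) 3] at hc
  push_cast at hc
  rw [h0, zero_mul, zero_add] at hc
  have hmod : Fintype.card F % 3 = 1 ∨ Fintype.card F % 3 = 2 := by omega
  rcases hmod with h' | h' <;> rw [h'] at hc <;> push_cast at hc
  · exact one_ne_zero hc
  · exact one_ne_zero (α := F) (by linear_combination h0 - hc)

/-- The Frobenius orbit of a root of `v³ - 3v + 1 = τ·v·(v-1)` in any extension field containing
a primitive cube root of unity. -/
theorem frobenius_apply_root_of_cubic {F K : Type*} [Field F] [Fintype F] [Field K] [Algebra F K]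
    (q : ℕ) (hq : Fintype.card F = q)
    (h3 : ¬ (3 ∣ q)) (ω : K) (hω : ω ^ 2 + ω + 1 = 0)
    (τ : F) (hτ : τ ^ 2 - 3 * τ + 9 ≠ 0)
    (v : K)
    (hv : v ^ 3 - 3 * v + 1 = algebraMap F K τ * v * (v - 1))
    (χ : K)
    (hχ : χ = ((algebraMap F K τ + 3 * ω ^ 2)
        / (algebraMap F K τ + 3 * ω)) ^ ((q ^ 2 - 1) / 3)) :
    (χ = 1 ∨ χ = ω ∨ χ = ω ^ 2) ∧
    (χ = 1 → v ^ q = v) ∧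
    (χ = ω → v ^ q = (v - 1) / v) ∧
    (χ = ω ^ 2 → v ^ q = 1 / (1 - v)) := by
  set t : K := algebraMap F K τ with ht
  have h30 : (3 : K) ≠ 0 := by
    have h := (map_ne_zero (algebraMap F K)).2
      (three_ne_zero_of_not_dvd_card (F := F) (hq ▸ h3))
    simpa only [map_ofNat] using h
  have hab : (t + 3 * ω) * (t + 3 * ω ^ 2) ≠ 0 := by
    have h := (map_ne_zero (algebraMap F K)).2 hτ
    simp only [map_add, map_sub, map_mul, map_pow, map_ofNat, ← ht] at h
    intro h'
    exact h (by linear_combination h' - (3 * t + 9 * (ω - 1)) * hω)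
  have hb := left_ne_zero_of_mul hab
  have ha := right_ne_zero_of_mul hab
  have hω3 : ω ^ 3 = 1 := by linear_combination (ω - 1) * hω
  have hω1 : ω - 1 ≠ 0 := by
    intro h
    exact h30 (by linear_combination hω - (ω + 2) * h)
  have hω0 : ω ≠ 0 := by
    intro h
    simp [h] at hω
  obtain ⟨hB, hA, hu⟩ := cube_fixedPoint_coordinate hω hb ha hv
  set φ : K →+* K := (FiniteField.frobeniusAlgHom F K).toRingHom
  have hφ : ∀ x, φ x = x ^ q := fun x => by
    rw [← hq]
    rfl
  have hφt : φ t = t := (FiniteField.frobeniusAlgHom F K).commutes τ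
  have hw : (φ v) ^ 3 - 3 * φ v + 1 = t * φ v * (φ v - 1) := by
    have h := congrArg φ hv
    simpa only [map_add, map_sub, map_mul, map_pow, map_ofNat, map_one, hφt] using h
  obtain ⟨hB', hA', hu'⟩ := cube_fixedPoint_coordinate hω hb ha hw
  set u := (v + ω ^ 2) / (v + ω) with hudef
  set u' := (φ v + ω ^ 2) / (φ v + ω) with hudef'
  have hu0 : u ≠ 0 := div_ne_zero hA hB
  obtain ⟨c, hc⟩ : ∃ c, u' = c * u := ⟨u' / u, (div_mul_cancel₀ _ hu0).symm⟩
  have hc3 : c ^ 3 = 1 := by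
    apply mul_right_cancel₀ (pow_ne_zero 3 hu0)
    rw [← mul_pow, ← hc, hu', hu, one_mul]
  have hpow : ∀ x : K, x ^ 3 = 1 → φ x = x ^ (q % 3) := fun x hx => by
    rw [hφ, pow_eq_pow_mod q hx]
  have hmod : q % 3 = 1 ∨ q % 3 = 2 := by omega
  have hdvd : 3 * ((q ^ 2 - 1) / 3) = q ^ 2 - 1 := by
    apply Nat.mul_div_cancel'
    apply (Nat.modEq_iff_dvd' (Nat.one_le_pow _ _ (by omega))).1
    rcases hmod with h | h <;> simp [Nat.ModEq, Nat.pow_mod, h]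
  have hχu : χ * u = φ (φ u) := by
    rw [hχ, ← hu, ← pow_mul, hdvd, ← pow_succ,
      Nat.sub_add_cancel (Nat.one_le_pow _ _ (by omega)), hφ, hφ, ← pow_mul, sq]
  have hχc : χ = c ^ 2 := by
    apply mul_right_cancel₀ hu0
    rw [hχu]
    rcases hmod with h | h
    · have hφω : φ ω = ω := by rw [hpow ω hω3, h, pow_one]
      have hφc : φ c = c := by rw [hpow c hc3, h, pow_one]
      have hφu : φ u = u' := by
        rw [hudef, map_div₀, map_add, map_add, map_pow, hφω]
      rw [hφu, hc, map_mul, hφc, hφu, hc]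
      ring
    · have hφω : φ ω = ω ^ 2 := by rw [hpow ω hω3, h]
      have hφc : φ c = c ^ 2 := by rw [hpow c hc3, h]
      have hφu : φ u = u'⁻¹ := by
        rw [hudef, map_div₀, map_add, map_add, map_pow, hφω, inv_div]
        congr 2
        linear_combination ω * hω3
      have hc0 : c ^ 2 ≠ 0 := by
        intro h0
        rw [pow_succ, h0] at hc3
        simp at hc3
      rw [hφu, map_inv₀, hc, map_mul, hφc, hφu, mul_inv, inv_inv, hc, inv_mul_eq_iff_eq_mul₀ hc0]
      linear_combination -c * u * hc3
  have hcχ : c = χ ^ 2 := by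
    rw [hχc]
    linear_combination -c * hc3
  have hcross : (φ v + ω ^ 2) * (v + ω) = χ ^ 2 * ((v + ω ^ 2) * (φ v + ω)) := by
    rw [hudef, hudef', hcχ] at hc
    field_simp at hc
    linear_combination hc
  have hv0 : v ≠ 0 := by
    intro h
    simp [h] at hv
  have hv1 : 1 - v ≠ 0 := by
    intro h
    obtain rfl : v = 1 := by linear_combination -h
    exact one_ne_zero (α := K) (by linear_combination -hv)
  rw [← hφ v]
  refine ⟨?_, fun h => ?_, fun h => ?_, fun h => ?_⟩
  · have hχ3 : (χ - 1) * ((χ - ω) * (χ - ω ^ 2)) = 0 := by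
      have : χ ^ 3 = 1 := by rw [hχc, ← pow_mul, mul_comm, pow_mul, hc3, one_pow]
      linear_combination this - (χ ^ 2 - χ) * hω + (χ - 1) * hω3
    simpa only [mul_eq_zero, sub_eq_zero] using hχ3
  · rw [h] at hcross
    apply mul_left_cancel₀ (mul_ne_zero hω0 hω1)
    linear_combination -hcross
  · rw [h] at hcross
    rw [eq_div_iff hv0]
    have hω2 : 1 - ω ^ 2 ≠ 0 := by
      intro h'
      exact hω1 (by linear_combination ω * h' + hω3)
    apply mul_left_cancel₀ hω2
    linear_combination hcross + (v - 1 + ω ^ 2 + φ v * ω) * hω3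
  · rw [h] at hcross
    rw [eq_div_iff hv1]
    apply mul_left_cancel₀ hω1
    linear_combination hcross +
      (φ v * v * ω + φ v * (ω ^ 3 + 1) + v * ω ^ 2 + ω * (ω ^ 3 + 1) - 1) * hω3

/-- Order-3 invariant away from characteristic 3: for `3 ∤ q`, `ω` a primitive cube root of
unity, `τ ∈ F_q` with `τ² - 3τ + 9 ≠ 0`, `v` with `v³ - 3v + 1 = τ·v·(v-1)`, and
`χ = ((τ+3ω²)/(τ+3ω))^{(q²-1)/3}`, one has `χ ∈ {1, ω, ω²}` and
`χ = 1 → v^q = v`, `χ = ω → v^q = (v-1)/v`, `χ = ω² → v^q = 1/(1-v)`. -/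
theorem stmt16 (F : Type*) [Field F] [Fintype F] (q : ℕ) (hq : Fintype.card F = q)
    (h3 : ¬ (3 ∣ q)) (ω : AlgebraicClosure F) (hω : ω ^ 2 + ω + 1 = 0)
    (τ : F) (hτ : τ ^ 2 - 3 * τ + 9 ≠ 0)
    (v : AlgebraicClosure F)
    (hv : v ^ 3 - 3 * v + 1 = algebraMap F (AlgebraicClosure F) τ * v * (v - 1))
    (χ : AlgebraicClosure F)
    (hχ : χ = ((algebraMap F (AlgebraicClosure F) τ + 3 * ω ^ 2)
        / (algebraMap F (AlgebraicClosure F) τ + 3 * ω)) ^ ((q ^ 2 - 1) / 3)) :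
    (χ = 1 ∨ χ = ω ∨ χ = ω ^ 2) ∧
    (χ = 1 → v ^ q = v) ∧
    (χ = ω → v ^ q = (v - 1) / v) ∧
    (χ = ω ^ 2 → v ^ q = 1 / (1 - v)) :=
  frobenius_apply_root_of_cubic q hq h3 ω hω τ hτ v hv χ hχ
end

section
/- Let q be a prime power, let λ ∈ F_{q^2} \ F_q, and let ℓ ≥ 1 be a divisor of q + 1. Let τ ∈ F_q, and let v ∈ F̄_q with v ∉ {λ, λ^q} satisfy ((v - λ^q)/(v - λ))^ℓ = (τ - λ^q)/(τ - λ). Then v^q ∉ {λ, λ^q}, and (v^q - λ^q)/(v^q - λ) = ζ · (v - λ^q)/(v - λ), where ζ = ((τ - λ)/(τ - λ^q))^{(q+1)/ℓ}; moreover ζ^ℓ = 1. -/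
/-- Artin invariant for the cyclic subgroup of order `ℓ ∣ q+1` fixing `λ, λ^q`: if
`((v-λ^q)/(v-λ))^ℓ = (τ-λ^q)/(τ-λ)` with `τ ∈ F_q` and `v ∉ {λ, λ^q}`, then
`v^q ∉ {λ, λ^q}` and `(v^q-λ^q)/(v^q-λ) = ζ·(v-λ^q)/(v-λ)` where
`ζ = ((τ-λ)/(τ-λ^q))^{(q+1)/ℓ}` satisfies `ζ^ℓ = 1`. -/
theorem stmt17 (F : Type*) [Field F] [Fintype F] (q : ℕ) (hq : Fintype.card F = q)
    (lam : AlgebraicClosure F) (hlam2 : lam ^ q ^ 2 = lam) (hlam1 : lam ^ q ≠ lam)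
    (ℓ : ℕ) (hℓ1 : 1 ≤ ℓ) (hℓ : ℓ ∣ q + 1)
    (τ : F) (v : AlgebraicClosure F) (hv1 : v ≠ lam) (hv2 : v ≠ lam ^ q)
    (hv : ((v - lam ^ q) / (v - lam)) ^ ℓ
        = (algebraMap F (AlgebraicClosure F) τ - lam ^ q)
          / (algebraMap F (AlgebraicClosure F) τ - lam)) :
    v ^ q ≠ lam ∧ v ^ q ≠ lam ^ q ∧
    (v ^ q - lam ^ q) / (v ^ q - lam)
      = ((algebraMap F (AlgebraicClosure F) τ - lam)
          / (algebraMap F (AlgebraicClosure F) τ - lam ^ q)) ^ ((q + 1) / ℓ)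
        * ((v - lam ^ q) / (v - lam)) ∧
    (((algebraMap F (AlgebraicClosure F) τ - lam)
        / (algebraMap F (AlgebraicClosure F) τ - lam ^ q)) ^ ((q + 1) / ℓ)) ^ ℓ = 1 := by
  have hsub : ∀ x y : AlgebraicClosure F, (x - y) ^ q = x ^ q - y ^ q := by
    intro x y
    subst hq
    exact map_sub (FiniteField.frobeniusAlgHom F (AlgebraicClosure F)) x y
  have hlam : (lam ^ q) ^ q = lam := by rw [← pow_mul, ← sq, hlam2]
  have hτq : algebraMap F (AlgebraicClosure F) τ ^ q = algebraMap F (AlgebraicClosure F) τ := by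
    rw [← map_pow, ← hq, FiniteField.pow_card]
  set t := algebraMap F (AlgebraicClosure F) τ
  have ht1 : t - lam ≠ 0 := by
    intro h
    rw [sub_eq_zero] at h
    exact hlam1 (h ▸ hτq)
  have hconj : (t - lam) ^ q = t - lam ^ q := by rw [hsub, hτq]
  have hconj' : (t - lam ^ q) ^ q = t - lam := by rw [hsub, hτq, hlam]
  have ht2 : t - lam ^ q ≠ 0 := hconj ▸ pow_ne_zero q ht1
  have hv1' : v - lam ≠ 0 := sub_ne_zero.mpr hv1
  have hv2' : v - lam ^ q ≠ 0 := sub_ne_zero.mpr hv2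
  have hvq1 : (v - lam) ^ q = v ^ q - lam ^ q := hsub _ _
  have hvq2 : (v - lam ^ q) ^ q = v ^ q - lam := by rw [hsub, hlam]
  have hw0 : (v - lam ^ q) / (v - lam) ≠ 0 := div_ne_zero hv2' hv1'
  have hinv : (t - lam) / (t - lam ^ q) = (((v - lam ^ q) / (v - lam)) ^ ℓ)⁻¹ := by
    rw [hv, inv_div]
  refine ⟨?_, ?_, ?_, ?_⟩
  · exact sub_ne_zero.mp (hvq2 ▸ pow_ne_zero q hv2')
  · exact sub_ne_zero.mp (hvq1 ▸ pow_ne_zero q hv1')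
  · rw [hinv, inv_pow, ← pow_mul, Nat.mul_div_cancel' hℓ, ← hvq1, ← hvq2, ← div_pow,
      ← inv_div (v - lam ^ q), inv_pow, pow_succ, mul_inv, mul_assoc, inv_mul_cancel₀ hw0, mul_one]
  · rw [← pow_mul, Nat.div_mul_cancel hℓ, pow_succ, div_pow, hconj, hconj']
    field_simp
end

section
/- Let q be an odd prime power, let a, b, c, d ∈ F_q with ad - bc ≠ 0, and let v ∈ F̄_q with v ∉ F_{q^2}. Set w = (av+b)/(cv+d) (well defined, since cv + d ≠ 0). Then w ∉ F_{q^2}, and (w^{q^2} - w)^{(q+1)/2}/(w^q - w)^{(q^2+1)/2} = (ad - bc)^{(q-1)/2} · (v^{q^2} - v)^{(q+1)/2}/(v^q - v)^{(q^2+1)/2}. (Here (ad-bc)^{(q-1)/2} ∈ {1,-1} is the quadratic character of the determinant; in particular the rational function Q_S(x) = (x^{q^2}-x)^{(q+1)/2}/(x^q-x)^{(q^2+1)/2} is invariant under the fractional-linear action of PSL_2(F_q).) -/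
/-- An algebra endomorphism moves a fractional-linear transform of `v` by the determinant times the
displacement of `v`, divided by the two denominators. -/
theorem AlgHom.map_mobius_sub {F L : Type*} [Field F] [Field L] [Algebra F L] (φ : L →ₐ[F] L)
    (a b c d : F) (v : L) (h : algebraMap F L c * v + algebraMap F L d ≠ 0) :
    φ ((algebraMap F L a * v + algebraMap F L b) / (algebraMap F L c * v + algebraMap F L d))
        - (algebraMap F L a * v + algebraMap F L b) / (algebraMap F L c * v + algebraMap F L d)
      = algebraMap F L (a * d - b * c) * (φ v - v)
        / ((algebraMap F L c * v + algebraMap F L d)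
          * φ (algebraMap F L c * v + algebraMap F L d)) := by
  have h' : φ (algebraMap F L c * v + algebraMap F L d) ≠ 0 := by
    rwa [Ne, map_eq_zero_iff φ φ.injective]
  rw [map_div₀, div_sub_div _ _ h' h,
    mul_comm (φ (algebraMap F L c * v + algebraMap F L d)) (algebraMap F L c * v + algebraMap F L d)]
  congr 1
  simp only [map_add, map_mul, map_sub, AlgHom.commutes]
  ring

/-- If an algebra endomorphism does not fix `v`, then `v` is not a root of a nonzero affine
polynomial over the base field. -/
theorem AlgHom.affine_ne_zero {F L : Type*} [Field F] [Field L] [Algebra F L] (φ : L →ₐ[F] L)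
    {c d : F} (hcd : c ≠ 0 ∨ d ≠ 0) {v : L} (hv : φ v ≠ v) :
    algebraMap F L c * v + algebraMap F L d ≠ 0 := by
  intro h
  have h1 : algebraMap F L c * φ v + algebraMap F L d = 0 := by
    simpa using congrArg φ h
  have h2 : algebraMap F L c * (φ v - v) = 0 := by linear_combination h1 - h
  have hc : c = 0 := by simpa [sub_eq_zero, hv] using h2
  have hd : d = 0 := by simpa [hc] using h
  exact hcd.elim (· hc) (· hd)


/-- `PSL_2`-invariance: for odd `q`, `[[a,b],[c,d]]` invertible over `F_q`, and `v ∉ F_{q^2}`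
in the algebraic closure, the element `w = (av+b)/(cv+d)` is well defined, `w ∉ F_{q^2}`, and
`(w^{q²}-w)^{(q+1)/2}/(w^q-w)^{(q²+1)/2}
  = (ad-bc)^{(q-1)/2} · (v^{q²}-v)^{(q+1)/2}/(v^q-v)^{(q²+1)/2}`. -/
theorem stmt18 (F : Type*) [Field F] [Fintype F] (q : ℕ) (hq : Fintype.card F = q)
    (hodd : Odd q) (a b c d : F) (hdet : a * d - b * c ≠ 0)
    (v : AlgebraicClosure F) (hv : v ^ q ^ 2 ≠ v) :
    algebraMap F (AlgebraicClosure F) c * v + algebraMap F (AlgebraicClosure F) d ≠ 0 ∧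
    ∀ w : AlgebraicClosure F,
      w = (algebraMap F (AlgebraicClosure F) a * v + algebraMap F (AlgebraicClosure F) b)
          / (algebraMap F (AlgebraicClosure F) c * v + algebraMap F (AlgebraicClosure F) d) →
      w ^ q ^ 2 ≠ w ∧
      (w ^ q ^ 2 - w) ^ ((q + 1) / 2) / (w ^ q - w) ^ ((q ^ 2 + 1) / 2)
        = algebraMap F (AlgebraicClosure F) ((a * d - b * c) ^ ((q - 1) / 2))
          * ((v ^ q ^ 2 - v) ^ ((q + 1) / 2) / (v ^ q - v) ^ ((q ^ 2 + 1) / 2)) := by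
  subst hq
  set q := Fintype.card F
  obtain ⟨k, hk⟩ := hodd
  let φ : AlgebraicClosure F →ₐ[F] AlgebraicClosure F :=
    FiniteField.frobeniusAlgHom F (AlgebraicClosure F)
  have hφ (x : AlgebraicClosure F) : φ x = x ^ q := rfl
  have hφ₂ (x : AlgebraicClosure F) : (φ.comp φ) x = x ^ q ^ 2 := by
    rw [AlgHom.comp_apply, hφ, hφ, ← pow_mul, sq]
  have hs : algebraMap F (AlgebraicClosure F) c * v + algebraMap F (AlgebraicClosure F) d ≠ 0 := by
    refine (φ.comp φ).affine_ne_zero ?_ (by rwa [hφ₂])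
    by_contra! h
    simp [h.1, h.2] at hdet
  refine ⟨hs, ?_⟩
  rintro w rfl
  have h₁ := φ.map_mobius_sub a b c d v hs
  have h₂ := (φ.comp φ).map_mobius_sub a b c d v hs
  rw [hφ, hφ, hφ] at h₁
  rw [hφ₂, hφ₂, hφ₂] at h₂
  have hδ : algebraMap F (AlgebraicClosure F) (a * d - b * c) ≠ 0 := (map_ne_zero _).mpr hdet
  have hδq : (a * d - b * c) ^ (q - 1) = 1 := FiniteField.pow_card_sub_one_eq_one _ hdet
  have hvq : v ^ q ^ 2 - v ≠ 0 := sub_ne_zero.mpr hv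
  constructor
  · rw [← sub_ne_zero, h₂]
    exact div_ne_zero (mul_ne_zero hδ hvq) (mul_ne_zero hs (pow_ne_zero _ hs))
  · have e₁ : (q + 1) / 2 = k + 1 := by omega
    have e₂ : (q ^ 2 + 1) / 2 = 2 * k * (k + 1) + 1 := by
      have : q ^ 2 + 1 = 2 * (2 * k * (k + 1) + 1) := by rw [hk]; ring
      omega
    have e₃ : (q - 1) / 2 = k := by omega
    have e₄ : q - 1 = 2 * k := by omega
    have hδm : algebraMap F (AlgebraicClosure F) (a * d - b * c) ^ (2 * k * (k + 1) + 1)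
        = algebraMap F (AlgebraicClosure F) (a * d - b * c) := by
      rw [← map_pow, pow_succ, pow_mul, ← e₄, hδq, one_pow, one_mul]
    rw [h₁, h₂, e₁, e₂, e₃, map_pow]
    generalize algebraMap F (AlgebraicClosure F) c * v + algebraMap F (AlgebraicClosure F) d = s at hs ⊢
    have hss : (s * s ^ q) ^ (2 * k * (k + 1) + 1) = (s * s ^ q ^ 2) ^ (k + 1) := by
      rw [← pow_succ', ← pow_succ', ← pow_mul, ← pow_mul, hk]
      ring
    have hs₀ : (s * s ^ q ^ 2) ^ (k + 1) ≠ 0 :=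
      pow_ne_zero _ (mul_ne_zero hs (pow_ne_zero _ hs))
    rw [div_pow, div_pow, hss, div_div_div_cancel_right₀ hs₀, mul_pow, mul_pow, hδm,
      pow_succ' (algebraMap F (AlgebraicClosure F) (a * d - b * c)), mul_assoc,
      mul_div_mul_left _ _ hδ, mul_div_assoc]
end

section
/- Let q be a prime power, let τ ∈ F_q^×, and let v ∈ F̄_q satisfy (v^q - v)^{q-1} = τ. Then v ∉ F_q, and: if τ ≠ 1, there exists b ∈ F_q such that v^q = τ·v + b; if τ = 1, there exists b ∈ F_q^× such that v^q = v + b. (This computes the Artin invariant of τ for the Borel subgroup B_q = { [[a,b],[0,1]] : a ∈ F_q^×, b ∈ F_q } of PGL_2(F_q) with quotient map Q(x) = (x^q - x)^{q-1}: it is the conjugacy class of diag(τ,1) when τ ≠ 1, and of [[1,1],[0,1]] when τ = 1.) -/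
/-- In an extension field of a finite field `F`, the solutions of `x ^ #F = x` lie in `F`. -/
theorem FiniteField.exists_algebraMap_eq_of_pow_card_eq {F L : Type*} [Field F] [Fintype F]
    [Field L] [Algebra F L] {x : L} (hx : x ^ Fintype.card F = x) :
    ∃ b : F, algebraMap F L b = x := by
  open Polynomial in
  have hcard := Fintype.one_lt_card (α := F)
  have hsplit : (X ^ Fintype.card F - X : F[X]).Splits := by
    rw [splits_iff_card_roots, FiniteField.roots_X_pow_card_sub_X,
      FiniteField.X_pow_card_sub_X_natDegree_eq F hcard]
    rfl
  have hmem : x ∈ ((X ^ Fintype.card F - X : F[X]).map (algebraMap F L)).roots := by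
    rw [Polynomial.map_sub, Polynomial.map_pow, map_X,
      mem_roots (FiniteField.X_pow_card_sub_X_ne_zero L hcard)]
    simp [hx]
  rw [hsplit.roots_map] at hmem
  obtain ⟨b, -, hb⟩ := Multiset.mem_map.mp hmem
  exact ⟨b, hb⟩

/-- Artin invariant for the Borel subgroup with quotient map `(x^q-x)^{q-1}`: if
`(v^q - v)^{q-1} = τ ∈ F_q^×` then `v ∉ F_q`, and `v^q = τ·v + b` for some `b ∈ F_q` when
`τ ≠ 1`, while `v^q = v + b` for some `b ∈ F_q^×` when `τ = 1`. -/
theorem stmt19 (F : Type*) [Field F] [Fintype F] (q : ℕ) (hq : Fintype.card F = q)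
    (τ : F) (hτ : τ ≠ 0) (v : AlgebraicClosure F)
    (hv : (v ^ q - v) ^ (q - 1) = algebraMap F (AlgebraicClosure F) τ) :
    v ^ q ≠ v ∧
    (τ ≠ 1 → ∃ b : F, v ^ q = algebraMap F (AlgebraicClosure F) τ * v
        + algebraMap F (AlgebraicClosure F) b) ∧
    (τ = 1 → ∃ b : F, b ≠ 0 ∧ v ^ q = v + algebraMap F (AlgebraicClosure F) b) := by
  subst hq
  have hcard := Fintype.one_lt_card (α := F)
  have hτ' : algebraMap F (AlgebraicClosure F) τ ≠ 0 := by simpa using hτ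
  have hne : v ^ Fintype.card F ≠ v := by
    intro h
    rw [h, sub_self, zero_pow (by omega)] at hv
    exact hτ' hv.symm
  have hfrob : (v ^ Fintype.card F - v) ^ Fintype.card F =
      algebraMap F (AlgebraicClosure F) τ * (v ^ Fintype.card F - v) := by
    rw [← hv, ← pow_succ, Nat.sub_add_cancel hcard.le]
  obtain ⟨b, hb⟩ : ∃ b : F, algebraMap F (AlgebraicClosure F) b =
      v ^ Fintype.card F - algebraMap F (AlgebraicClosure F) τ * v := by
    apply FiniteField.exists_algebraMap_eq_of_pow_card_eq
    have hsub := map_sub (FiniteField.frobeniusAlgHom F (AlgebraicClosure F))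
    simp only [FiniteField.coe_frobeniusAlgHom] at hsub
    rw [hsub] at hfrob ⊢
    rw [mul_pow, ← map_pow, FiniteField.pow_card]
    linear_combination hfrob
  refine ⟨hne, fun _ ↦ ⟨b, by rw [hb]; ring⟩, ?_⟩
  rintro rfl
  rw [map_one, one_mul] at hb
  refine ⟨b, ?_, by rw [hb]; ring⟩
  rintro rfl
  rw [map_zero] at hb
  exact hne (sub_eq_zero.mp hb.symm)
end
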